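/- Let L : ℝ^n → ℝ be real-analytic and coercive, i.e. L(x) → +∞ as ‖x‖ → +∞. Consider gradient descent with constant stepsize μ > 0: x_{t+1} = x_t − μ ∇L(x_t). There exists μ0 > 0 such that for every μ ∈ (0, μ0]: (i) for every initialization x_0 in the closed unit ball B(0,1), the sequence (x_t)_{t∈ℕ} converges and its limit x_∞ satisfies ∇L(x_∞) = 0; (ii) for Lebesgue-almost every x_0 ∈ B(0,1), the limit additionally satisfies ∇²L(x_∞) ⪰ 0 (the Hessian at the limit is positive semidefinite). -/

import Mathlib

open MeasureTheory Filter
open Topology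

namespace AnalyticDescent

@[fun_prop]
theorem analyticAt_coord {n : ℕ} (i : Fin n) (p : Fin n → ℝ) :
    AnalyticAt ℝ (fun x : Fin n → ℝ => x i) p :=
  (ContinuousLinearMap.proj (R := ℝ) (φ := fun _ : Fin n => ℝ) i).analyticAt p

/-- Averaging an analytic function over a continuous family of linear contractions is analytic. -/
theorem analyticAt_integral_comp_clm {E : Type*} [NormedAddCommGroup E] [NormedSpace ℝ E]
    {f : E → ℝ} (hf : AnalyticAt ℝ f 0) (D : ℝ → E →L[ℝ] E) (hD : Continuous D)
    (hD1 : ∀ t ∈ Set.Icc (0 : ℝ) 1, ‖D t‖ ≤ 1) :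
    AnalyticAt ℝ (fun x => ∫ t in (0 : ℝ)..1, f (D t x)) 0 := by
  obtain ⟨p, r, hp⟩ := hf
  let R : (k : ℕ) → ℝ → ContinuousMultilinearMap ℝ (fun _ : Fin k => E) ℝ :=
    fun k t => (p k).compContinuousLinearMap (fun _ => D t)
  have hRc : ∀ k, Continuous (R k) := by
    intro k
    have h1 : Continuous fun t => (ContinuousMultilinearMap.compContinuousLinearMapContinuousMultilinear
        ℝ (fun _ : Fin k => E) (fun _ : Fin k => E) ℝ) (fun _ => D t) :=
      (ContinuousMultilinearMap.cont _).comp (continuous_pi fun _ => hD)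
    exact h1.clm_apply continuous_const
  have hRn : ∀ k, ∀ t ∈ Set.Icc (0 : ℝ) 1, ‖R k t‖ ≤ ‖p k‖ := by
    intro k t ht
    refine (ContinuousMultilinearMap.norm_compContinuousLinearMap_le _ _).trans ?_
    have : ∏ _i : Fin k, ‖D t‖ ≤ 1 := Finset.prod_le_one (fun _ _ => norm_nonneg _)
      (fun _ _ => hD1 t ht)
    nlinarith [norm_nonneg (p k)]
  let q : FormalMultilinearSeries ℝ E ℝ := fun k => ∫ t in (0 : ℝ)..1, R k t
  have hq : ∀ k, ‖q k‖ ≤ ‖p k‖ := by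
    intro k
    have := intervalIntegral.norm_integral_le_of_norm_le_const (a := (0 : ℝ)) (b := 1)
      (f := R k) (C := ‖p k‖) (fun t ht => hRn k t (by
        rw [Set.uIoc_of_le zero_le_one] at ht; exact ⟨ht.1.le, ht.2⟩))
    simpa using this
  refine ⟨q, r, hp.r_le.trans (FormalMultilinearSeries.radius_le_of_le hq), hp.r_pos, ?_⟩
  intro y hy
  have hyp : y ∈ Metric.eball (0 : E) p.radius := Metric.eball_subset_eball hp.r_le hy
  have hDy : ∀ t ∈ Set.Icc (0 : ℝ) 1, ‖D t y‖ ≤ ‖y‖ := fun t ht =>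
    ((D t).le_opNorm y).trans (by nlinarith [hD1 t ht, norm_nonneg y])
  have key : ∀ k, (q k) (fun _ => y) = ∫ t in (0 : ℝ)..1, (p k) (fun _ => D t y) := by
    intro k
    have := ContinuousLinearMap.intervalIntegral_comp_comm (μ := volume) (a := (0 : ℝ)) (b := 1)
      (ContinuousMultilinearMap.apply ℝ (fun _ : Fin k => E) ℝ (fun _ => y))
      ((hRc k).intervalIntegrable 0 1)
    simpa [R, q] using this.symm
  let F : ℕ → C(ℝ, ℝ) := fun k => ⟨fun t => (p k) (fun _ => D t y),
    (p k).cont.comp (continuous_pi fun _ => hD.clm_apply continuous_const)⟩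
  have hnorm : Summable fun k => ‖p k‖ * ‖y‖ ^ k := by
    have hy' : ((‖y‖₊ : NNReal) : ENNReal) < p.radius := by
      rw [Metric.mem_eball, edist_zero_right] at hyp
      exact hyp
    simpa using p.summable_norm_mul_pow hy'
  have hsum := intervalIntegral.hasSum_intervalIntegral_of_summable_norm (a := (0 : ℝ)) (b := 1)
    (f := F) (by
      refine Summable.of_nonneg_of_le (fun _ => norm_nonneg _) (fun k => ?_) hnorm
      rw [ContinuousMap.norm_le _ (by positivity)]
      rintro ⟨t, ht⟩
      have ht' : t ∈ Set.Icc (0 : ℝ) 1 := by simpa [Set.uIcc_of_le zero_le_one] using ht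
      refine ((p k).le_opNorm _).trans ?_
      simp only [Finset.prod_const, Finset.card_univ, Fintype.card_fin]
      gcongr
      exact hDy t ht')
  simp only [key, zero_add]
  convert! hsum using 1
  refine intervalIntegral.integral_congr fun t ht => ?_
  have ht' : t ∈ Set.Icc (0 : ℝ) 1 := by simpa [Set.uIcc_of_le zero_le_one] using ht
  have hmem : D t y ∈ Metric.eball (0 : E) r := by
    simp only [Metric.mem_eball, edist_zero_right] at hy ⊢
    exact lt_of_le_of_lt (enorm_le_iff_norm_le.2 (hDy t ht')) hy
  have := (hp.hasSum hmem).tsum_eq.symm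
  rwa [zero_add] at this

theorem analyticAt_fderiv_apply {E : Type*} [NormedAddCommGroup E] [NormedSpace ℝ E]
    {f : E → ℝ} {x : E} (hf : AnalyticAt ℝ f x) (e : E) :
    AnalyticAt ℝ (fun y => fderiv ℝ f y e) x :=
  ((ContinuousLinearMap.apply ℝ ℝ e).analyticAt _).comp hf.fderiv

/-- Multiplication of the `i`-th coordinate by `t`. -/
noncomputable def scaleCoord {n : ℕ} (i : Fin n) (t : ℝ) : (Fin n → ℝ) →L[ℝ] (Fin n → ℝ) :=
  ContinuousLinearMap.id ℝ _ +
    (t - 1) • (ContinuousLinearMap.proj (R := ℝ) (φ := fun _ : Fin n => ℝ) i).smulRight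
      (Pi.single i (1 : ℝ) : Fin n → ℝ)

theorem scaleCoord_apply {n : ℕ} (i : Fin n) (t : ℝ) (x : Fin n → ℝ) :
    scaleCoord i t x = Function.update x i (t * x i) := by
  ext j
  by_cases h : j = i
  · subst h; simp [scaleCoord]; ring
  · simp [scaleCoord, h]

/-- Analytic division by a coordinate. -/
theorem exists_div_coord {n : ℕ} {f : (Fin n → ℝ) → ℝ} (hf : AnalyticAt ℝ f 0) (i : Fin n) :
    ∃ g, AnalyticAt ℝ g 0 ∧ ∀ᶠ x in 𝓝 (0 : Fin n → ℝ),
      f x = f (Function.update x i 0) + x i * g x := by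
  let e : Fin n → ℝ := Pi.single i 1
  have hc : Continuous (fun t : ℝ => scaleCoord (n := n) i t) := by
    unfold scaleCoord; fun_prop
  have h1 : ∀ t ∈ Set.Icc (0 : ℝ) 1, ∀ x : Fin n → ℝ, ‖scaleCoord i t x‖ ≤ ‖x‖ := by
    intro t ht x
    rw [scaleCoord_apply, pi_norm_le_iff_of_nonneg (norm_nonneg _)]
    intro j
    by_cases h : j = i
    · subst h
      simp only [Function.update_self, norm_mul, Real.norm_eq_abs, abs_of_nonneg ht.1]
      have := norm_le_pi_norm x j
      rw [Real.norm_eq_abs] at this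
      nlinarith [abs_nonneg (x j), ht.2]
    · simpa [h] using norm_le_pi_norm x j
  have hder : AnalyticAt ℝ (fun x => fderiv ℝ f x e) 0 := analyticAt_fderiv_apply hf e
  refine ⟨fun x => ∫ t in (0 : ℝ)..1, fderiv ℝ f (scaleCoord i t x) e,
    analyticAt_integral_comp_clm hder _ hc
      (fun t ht => ContinuousLinearMap.opNorm_le_bound _ zero_le_one (by simpa using h1 t ht)), ?_⟩
  obtain ⟨ε, hε, hball⟩ := Metric.eventually_nhds_iff_ball.1 hf.eventually_analyticAt
  filter_upwards [Metric.ball_mem_nhds (0 : Fin n → ℝ) hε] with x hx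
  have hin : ∀ t ∈ Set.Icc (0 : ℝ) 1, AnalyticAt ℝ f (scaleCoord i t x) := fun t ht => by
    apply hball
    rw [mem_ball_zero_iff] at hx ⊢
    exact (h1 t ht x).trans_lt hx
  have hcx : Continuous (fun t : ℝ => scaleCoord (n := n) i t x) := hc.clm_apply continuous_const
  have hd : ∀ t ∈ Set.uIcc (0 : ℝ) 1, HasDerivAt (fun t => f (scaleCoord i t x))
      (x i * fderiv ℝ f (scaleCoord i t x) e) t := by
    intro t ht
    rw [Set.uIcc_of_le zero_le_one] at ht
    have h2 : HasDerivAt (fun t : ℝ => scaleCoord i t x) (x i • e) t := by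
      have : (fun t : ℝ => scaleCoord i t x) = fun t => x + (t - 1) • (x i • e) := by
        ext t j; simp [scaleCoord, e]
      rw [this]
      simpa using (((hasDerivAt_id t).sub_const 1).smul_const (x i • e)).const_add x
    have := (hin t ht).differentiableAt.hasFDerivAt.comp_hasDerivAt t h2
    rw [map_smul, smul_eq_mul] at this
    exact this
  have hint : IntervalIntegrable (fun t => x i * fderiv ℝ f (scaleCoord i t x) e) volume 0 1 := by
    apply ContinuousOn.intervalIntegrable
    intro t ht
    rw [Set.uIcc_of_le zero_le_one] at ht
    have h3 : ContinuousAt (fun y => fderiv ℝ f y e) (scaleCoord i t x) :=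
      (analyticAt_fderiv_apply (hin t ht) e).continuousAt
    exact (continuousAt_const.mul (ContinuousAt.comp (f := fun t => scaleCoord i t x) h3 hcx.continuousAt)).continuousWithinAt
  have := intervalIntegral.integral_eq_sub_of_hasDerivAt hd hint
  rw [intervalIntegral.integral_const_mul] at this
  simp only [scaleCoord_apply, one_mul, zero_mul, Function.update_eq_self] at this ⊢
  linarith

section Germs

variable {E : Type*} [NormedAddCommGroup E] [NormedSpace ℝ E]

theorem eventually_eventuallyEq_zero_imp {f : E → ℝ} (hf : AnalyticAt ℝ f 0) :
    ∀ᶠ p in 𝓝 (0 : E), (f =ᶠ[𝓝 p] 0 → f =ᶠ[𝓝 0] 0) := by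
  obtain ⟨ε, hε, hball⟩ := Metric.eventually_nhds_iff_ball.1 hf.eventually_analyticAt
  filter_upwards [Metric.ball_mem_nhds (0 : E) hε] with p hp h0
  have hon : AnalyticOnNhd ℝ f (Metric.ball 0 ε) := fun x hx => hball x hx
  have := hon.eqOn_zero_of_preconnected_of_eventuallyEq_zero
    (convex_ball (0 : E) ε).isPreconnected hp h0
  filter_upwards [Metric.ball_mem_nhds (0 : E) hε] with q hq using this hq

theorem eventuallyEq_zero_or_of_mul {f g : E → ℝ} (hf : AnalyticAt ℝ f 0)
    (hg : AnalyticAt ℝ g 0) (h : ∀ᶠ x in 𝓝 0, f x * g x = 0) :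
    f =ᶠ[𝓝 0] 0 ∨ g =ᶠ[𝓝 0] 0 := by
  by_contra! hcon
  obtain ⟨h1, h2⟩ := hcon
  have h3 : ∃ᶠ p in 𝓝 (0 : E), f p ≠ 0 := fun h => h1 (by
    filter_upwards [h] with p hp
    simpa using hp)
  obtain ⟨p, hp, hp1, hp2, hp3⟩ := (h3.and_eventually ((eventually_eventually_nhds.2 h).and
    (hf.eventually_analyticAt.and (eventually_eventuallyEq_zero_imp hg)))).exists
  refine h2 (hp3 ?_)
  filter_upwards [hp1, hp2.continuousAt.eventually_ne hp] with q hq hq'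
  exact (mul_eq_zero.1 hq).resolve_left hq'

end Germs

variable {n : ℕ}

/-- The monomial with exponent `α`. -/
def mon (α : Fin n → ℕ) (x : Fin n → ℝ) : ℝ := ∏ i, x i ^ α i

theorem mon_add (α β : Fin n → ℕ) (x : Fin n → ℝ) : mon (α + β) x = mon α x * mon β x := by
  simp [mon, pow_add, Finset.prod_mul_distrib]

theorem mon_smul (k : ℕ) (α : Fin n → ℕ) (x : Fin n → ℝ) : mon (k • α) x = mon α x ^ k := by
  simp [mon, ← Finset.prod_pow, pow_mul, mul_comm k]

@[simp] theorem mon_zero (x : Fin n → ℝ) : mon 0 x = 1 := by simp [mon]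

theorem mon_single (i : Fin n) (x : Fin n → ℝ) : mon (Pi.single i 1) x = x i := by
  unfold mon
  rw [Finset.prod_eq_single i] <;> simp +contextual

theorem mon_ne_zero {α : Fin n → ℕ} {x : Fin n → ℝ} (h : ∀ i, x i = 0 → α i = 0) :
    mon α x ≠ 0 := by
  unfold mon
  refine Finset.prod_ne_zero_iff.2 fun i _ => ?_
  by_cases hx : x i = 0
  · simp [h i hx]
  · exact pow_ne_zero _ hx

theorem mon_eq_zero {α : Fin n → ℕ} {x : Fin n → ℝ} (i : Fin n) (h : x i = 0) (hα : α i ≠ 0) :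
    mon α x = 0 :=
  Finset.prod_eq_zero (Finset.mem_univ i) (by simp [h, hα])

theorem mon_at_zero {α : Fin n → ℕ} (hα : α ≠ 0) : mon α (0 : Fin n → ℝ) = 0 := by
  obtain ⟨i, hi⟩ := Function.ne_iff.1 hα
  exact mon_eq_zero i rfl hi

theorem mon_cons (a : ℕ) (α : Fin n → ℕ) (x : Fin (n + 1) → ℝ) :
    mon (Fin.cons a α : Fin (n + 1) → ℕ) x = x 0 ^ a * mon α (Fin.tail x) := by
  simp [mon, Fin.prod_univ_succ, Fin.tail]

@[fun_prop]
theorem analyticAt_mon (α : Fin n → ℕ) (p : Fin n → ℝ) : AnalyticAt ℝ (mon α) p := by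
  unfold mon; fun_prop

theorem exists_eq_add_single {α : Fin n → ℕ} {i : Fin n} (h : α i ≠ 0) :
    ∃ β : Fin n → ℕ, α = Pi.single i 1 + β ∧ ∑ k, β k < ∑ k, α k := by
  refine ⟨α - Pi.single i 1, ?_, ?_⟩
  · ext k
    by_cases hk : k = i
    · subst hk; simp; omega
    · simp [hk]
  · refine Finset.sum_lt_sum (fun k _ => by simp) ⟨i, Finset.mem_univ _, ?_⟩
    simp; omega

theorem frequently_zero_iff (S : Set (Fin n)) :
    ∃ᶠ p in 𝓝 (0 : Fin n → ℝ), ∀ k, p k = 0 ↔ k ∈ S := by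
  classical
  have h : Tendsto (fun t : ℝ => fun k : Fin n => if k ∈ S then (0 : ℝ) else t) (𝓝[≠] 0) (𝓝 0) := by
    rw [tendsto_pi_nhds]
    intro k
    by_cases hk : k ∈ S
    · simp [hk]
    · simp only [hk, if_false]
      exact tendsto_id.mono_left nhdsWithin_le_nhds
  refine h.frequently (Eventually.frequently ?_)
  filter_upwards [self_mem_nhdsWithin] with t ht k
  have ht : t ≠ 0 := ht
  by_cases hk : k ∈ S <;> simp [hk, ht]

/-- A germ at the origin of the form monomial times analytic unit. -/
def IsNormalCrossing (f : (Fin n → ℝ) → ℝ) : Prop :=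
  ∃ (α : Fin n → ℕ) (u : (Fin n → ℝ) → ℝ), AnalyticAt ℝ u 0 ∧ u 0 ≠ 0 ∧
    ∀ᶠ x in 𝓝 0, f x = mon α x * u x

theorem IsNormalCrossing.congr {f g : (Fin n → ℝ) → ℝ} (hf : IsNormalCrossing f)
    (h : ∀ᶠ x in 𝓝 0, g x = f x) : IsNormalCrossing g := by
  obtain ⟨α, u, hu, hu0, hfu⟩ := hf
  exact ⟨α, u, hu, hu0, by filter_upwards [h, hfu] with x h1 h2; rw [h1, h2]⟩

theorem isNormalCrossing_of_ne_zero {f : (Fin n → ℝ) → ℝ} (hf : AnalyticAt ℝ f 0)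
    (h : f 0 ≠ 0) : IsNormalCrossing f := ⟨0, f, hf, h, by simp⟩

theorem isNormalCrossing_one : IsNormalCrossing (fun _ : Fin n → ℝ => (1 : ℝ)) :=
  isNormalCrossing_of_ne_zero analyticAt_const one_ne_zero

theorem isNormalCrossing_mon (α : Fin n → ℕ) : IsNormalCrossing (mon α) :=
  ⟨α, fun _ => 1, analyticAt_const, one_ne_zero, by simp⟩

theorem isNormalCrossing_coord (i : Fin n) : IsNormalCrossing (fun x : Fin n → ℝ => x i) :=
  (isNormalCrossing_mon (Pi.single i 1)).congr (by simp [mon_single])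

theorem IsNormalCrossing.mul {f g : (Fin n → ℝ) → ℝ} (hf : IsNormalCrossing f)
    (hg : IsNormalCrossing g) : IsNormalCrossing (fun x => f x * g x) := by
  obtain ⟨α, u, hu, hu0, hfu⟩ := hf
  obtain ⟨β, v, hv, hv0, hgv⟩ := hg
  refine ⟨α + β, fun x => u x * v x, hu.mul hv, mul_ne_zero hu0 hv0, ?_⟩
  filter_upwards [hfu, hgv] with x h1 h2
  rw [h1, h2, mon_add]; ring

theorem IsNormalCrossing.pow {f : (Fin n → ℝ) → ℝ} (hf : IsNormalCrossing f) (k : ℕ) :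
    IsNormalCrossing (fun x => f x ^ k) := by
  induction k with
  | zero => simpa using isNormalCrossing_one
  | succ k ih => simpa [pow_succ] using ih.mul hf

theorem isNormalCrossing_prod {ι : Type*} (s : Finset ι) {f : ι → (Fin n → ℝ) → ℝ}
    (hf : ∀ i ∈ s, IsNormalCrossing (f i)) : IsNormalCrossing (fun x => ∏ i ∈ s, f i x) := by
  classical
  induction s using Finset.induction_on with
  | empty => simpa using isNormalCrossing_one
  | insert a s ha ih =>
    simp only [Finset.prod_insert ha]
    exact (hf a (by simp)).mul (ih fun i hi => hf i (by simp [hi]))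

theorem IsNormalCrossing.not_eventually_zero {f : (Fin n → ℝ) → ℝ} (hf : IsNormalCrossing f) :
    ¬ f =ᶠ[𝓝 0] 0 := by
  obtain ⟨α, u, hu, hu0, hfu⟩ := hf
  intro h
  obtain ⟨p, hp, h1, h2, h3⟩ := ((frequently_zero_iff (∅ : Set (Fin n))).and_eventually
    (h.and (hfu.and (hu.continuousAt.eventually_ne hu0)))).exists
  rw [h2] at h1
  exact mul_ne_zero (mon_ne_zero (by simp [hp])) h3 h1

theorem IsNormalCrossing.comp {m : ℕ} {f : (Fin n → ℝ) → ℝ} (hf : IsNormalCrossing f)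
    {φ : (Fin m → ℝ) → Fin n → ℝ} (hφ : AnalyticAt ℝ φ 0) (hφ0 : φ 0 = 0)
    (h : ∀ i, IsNormalCrossing (fun y => φ y i)) : IsNormalCrossing (fun y => f (φ y)) := by
  obtain ⟨α, u, hu, hu0, hfu⟩ := hf
  have h1 : IsNormalCrossing (fun y => ∏ i, φ y i ^ α i) :=
    isNormalCrossing_prod _ fun i _ => (h i).pow _
  have h2 : IsNormalCrossing (fun y => u (φ y)) :=
    isNormalCrossing_of_ne_zero (AnalyticAt.comp (by rwa [hφ0]) hφ) (by rwa [hφ0])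
  refine (h1.mul h2).congr ?_
  have := hφ.continuousAt.eventually (p := fun x => f x = mon α x * u x) (by rwa [hφ0])
  filter_upwards [this] with y hy using hy

theorem eventually_eq_of_coord_mul {f g : (Fin n → ℝ) → ℝ} (hf : AnalyticAt ℝ f 0)
    (hg : AnalyticAt ℝ g 0) (i : Fin n) (h : ∀ᶠ x in 𝓝 0, x i * f x = x i * g x) :
    ∀ᶠ x in 𝓝 0, f x = g x := by
  have := eventuallyEq_zero_or_of_mul (analyticAt_coord i 0) (hf.sub hg) (by
    filter_upwards [h] with x hx
    simp [mul_sub, hx])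
  rcases this with h1 | h1
  · exact absurd h1 (isNormalCrossing_coord i).not_eventually_zero
  · filter_upwards [h1] with x hx
    simpa [sub_eq_zero] using hx

theorem isNormalCrossing_left_of_mul {f g u : (Fin n → ℝ) → ℝ} {α : Fin n → ℕ}
    (hf : AnalyticAt ℝ f 0) (hg : AnalyticAt ℝ g 0) (hu : AnalyticAt ℝ u 0) (hu0 : u 0 ≠ 0)
    (h : ∀ᶠ x in 𝓝 0, f x * g x = mon α x * u x) : IsNormalCrossing f := by
  induction hN : ∑ k, α k using Nat.strong_induction_on generalizing f g α with
  | _ N ih =>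
  by_cases hα : α = 0
  · refine isNormalCrossing_of_ne_zero hf fun h0 => hu0 ?_
    simpa [hα, h0] using h.self_of_nhds.symm
  obtain ⟨i, hi⟩ := Function.ne_iff.1 hα
  obtain ⟨β, rfl, hβ⟩ := exists_eq_add_single hi
  simp only [mon_add, mon_single] at h
  have hρ : AnalyticAt ℝ (fun x : Fin n → ℝ => Function.update x i (0 : ℝ)) 0 := by
    have : (fun x : Fin n → ℝ => Function.update x i (0 : ℝ)) = fun x => scaleCoord i 0 x := by
      ext x; simp [scaleCoord_apply]
    rw [this]
    exact (scaleCoord i 0).analyticAt _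
  have hρ0 : Function.update (0 : Fin n → ℝ) i (0 : ℝ) = 0 := by simp
  have hz : ∀ᶠ x in 𝓝 (0 : Fin n → ℝ), f (Function.update x i 0) * g (Function.update x i 0) = 0 := by
    have := hρ.continuousAt.eventually (p := fun x => f x * g x = x i * mon β x * u x)
      (by simpa only [hρ0] using h)
    filter_upwards [this] with x hx
    simpa using hx
  have hfr : AnalyticAt ℝ (fun x => f (Function.update x i 0)) 0 :=
    AnalyticAt.comp (g := f) (by rwa [hρ0]) hρ
  have hgr : AnalyticAt ℝ (fun x => g (Function.update x i 0)) 0 :=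
    AnalyticAt.comp (g := g) (by rwa [hρ0]) hρ
  rcases eventuallyEq_zero_or_of_mul hfr hgr hz with h1 | h1
  · obtain ⟨f', hf', hff'⟩ := exists_div_coord hf i
    have hff : ∀ᶠ x in 𝓝 0, f x = x i * f' x := by
      filter_upwards [hff', h1] with x hx hx1
      rw [hx, hx1]; simp
    have : ∀ᶠ x in 𝓝 0, f' x * g x = mon β x * u x := by
      refine eventually_eq_of_coord_mul (hf'.mul hg) ((analyticAt_mon _ _).mul hu) i ?_
      filter_upwards [hff, h] with x hx hx1
      rw [hx] at hx1
      linarith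
    exact ((isNormalCrossing_coord i).mul (ih _ (hN ▸ hβ) hf' hg this rfl)).congr hff
  · obtain ⟨g', hg', hgg'⟩ := exists_div_coord hg i
    have hgg : ∀ᶠ x in 𝓝 0, g x = x i * g' x := by
      filter_upwards [hgg', h1] with x hx hx1
      rw [hx, hx1]; simp
    have : ∀ᶠ x in 𝓝 0, f x * g' x = mon β x * u x := by
      refine eventually_eq_of_coord_mul (hf.mul hg') ((analyticAt_mon _ _).mul hu) i ?_
      filter_upwards [hgg, h] with x hx hx1
      rw [hx] at hx1
      linarith
    exact ih _ (hN ▸ hβ) hf hg' this rfl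

theorem IsNormalCrossing.left_of_mul {f g : (Fin n → ℝ) → ℝ} (hf : AnalyticAt ℝ f 0)
    (hg : AnalyticAt ℝ g 0) (h : IsNormalCrossing (fun x => f x * g x)) : IsNormalCrossing f := by
  obtain ⟨α, u, hu, hu0, hfu⟩ := h
  exact isNormalCrossing_left_of_mul hf hg hu hu0 hfu

theorem IsNormalCrossing.right_of_mul {f g : (Fin n → ℝ) → ℝ} (hf : AnalyticAt ℝ f 0)
    (hg : AnalyticAt ℝ g 0) (h : IsNormalCrossing (fun x => f x * g x)) : IsNormalCrossing g :=
  IsNormalCrossing.left_of_mul hg hf (by simpa [mul_comm] using h)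

theorem IsNormalCrossing.of_prod {ι : Type*} {s : Finset ι} {f : ι → (Fin n → ℝ) → ℝ}
    (hf : ∀ i ∈ s, AnalyticAt ℝ (f i) 0) (h : IsNormalCrossing (fun x => ∏ i ∈ s, f i x))
    {i : ι} (hi : i ∈ s) : IsNormalCrossing (f i) := by
  classical
  refine IsNormalCrossing.left_of_mul (g := fun x => ∏ j ∈ s.erase i, f j x) (hf i hi) ?_ ?_
  · exact Finset.analyticAt_fun_prod _ fun j hj => hf j (Finset.mem_of_mem_erase hj)
  · exact h.congr (Eventually.of_forall fun x => Finset.mul_prod_erase s (fun j => f j x) hi)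

theorem not_eventually_zero_prod {ι : Type*} {s : Finset ι} {f : ι → (Fin n → ℝ) → ℝ}
    (hf : ∀ i ∈ s, AnalyticAt ℝ (f i) 0) (h : ∀ i ∈ s, ¬ f i =ᶠ[𝓝 0] 0) :
    ¬ (fun x => ∏ i ∈ s, f i x) =ᶠ[𝓝 0] 0 := by
  classical
  induction s using Finset.induction_on with
  | empty => intro h; simpa using h.self_of_nhds
  | insert a s ha ih =>
    intro h0
    simp only [Finset.prod_insert ha] at h0
    rcases eventuallyEq_zero_or_of_mul (hf a (by simp))
      (Finset.analyticAt_fun_prod s fun j hj => hf j (by simp [hj])) h0 with h1 | h1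
    · exact h a (by simp) h1
    · exact ih (fun i hi => hf i (by simp [hi])) (fun i hi => h i (by simp [hi])) h1

/-- Two normal crossings whose difference is normal crossing or zero have comparable exponents. -/
theorem exponents_comparable {α β : Fin n → ℕ} {u v : (Fin n → ℝ) → ℝ}
    (hu : AnalyticAt ℝ u 0) (hu0 : u 0 ≠ 0) (hv : AnalyticAt ℝ v 0) (hv0 : v 0 ≠ 0)
    (h : (∀ᶠ x in 𝓝 0, mon α x * u x - mon β x * v x = 0) ∨
      IsNormalCrossing (fun x => mon α x * u x - mon β x * v x)) : α ≤ β ∨ β ≤ α := by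
  by_contra! hcon
  simp only [Pi.le_def, not_forall, not_le] at hcon
  obtain ⟨⟨j, hj⟩, ⟨i, hi⟩⟩ := hcon
  set δ : Fin n → ℕ := fun k => min (α k) (β k) with hδ
  set α' : Fin n → ℕ := fun k => α k - δ k with hα'
  set β' : Fin n → ℕ := fun k => β k - δ k with hβ'
  have hα : α = δ + α' := by ext k; simp [hα', hδ]
  have hβ : β = δ + β' := by ext k; simp [hβ', hδ]
  have hαi : α' i = 0 := by simp [hα', hδ]; omega
  have hβi : β' i ≠ 0 := by simp [hβ', hδ]; omega
  have hβj : β' j = 0 := by simp [hβ', hδ]; omega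
  have hαj : α' j ≠ 0 := by simp [hα', hδ]; omega
  have hαβ : ∀ k, α' k = 0 ∨ β' k = 0 := fun k => by simp [hα', hβ', hδ]; omega
  have hfac : ∀ x, mon α x * u x - mon β x * v x =
      mon δ x * (mon α' x * u x - mon β' x * v x) := fun x => by
    conv_lhs => rw [hα, hβ]
    rw [mon_add, mon_add]; ring
  simp only [hfac] at h
  have hH : AnalyticAt ℝ (fun x => mon α' x * u x - mon β' x * v x) 0 := by fun_prop
  have hu' := hu.continuousAt.eventually_ne hu0
  have hv' := hv.continuousAt.eventually_ne hv0
  rcases h with h | h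
  · rcases eventuallyEq_zero_or_of_mul (analyticAt_mon δ 0) hH h with h | h
    · exact (isNormalCrossing_mon δ).not_eventually_zero h
    · obtain ⟨p, hp, h1, h2⟩ := ((frequently_zero_iff ({i} : Set (Fin n))).and_eventually
        (h.and hu')).exists
      simp only [Pi.zero_apply, mon_eq_zero i ((hp i).2 rfl) hβi, zero_mul, sub_zero] at h1
      refine mul_ne_zero (mon_ne_zero fun k hk => ?_) h2 h1
      have : k = i := (hp k).1 hk
      rw [this, hαi]
  · obtain ⟨γ, w, hw, hw0, hγ⟩ := IsNormalCrossing.right_of_mul (analyticAt_mon δ 0) hH h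
    have hγ0 : γ ≠ 0 := by
      rintro rfl
      have := hγ.self_of_nhds
      simp only [mon_at_zero (Function.ne_iff.2 ⟨j, hαj⟩),
        mon_at_zero (Function.ne_iff.2 ⟨i, hβi⟩), mon_zero] at this
      exact hw0 (by linarith)
    obtain ⟨k, hk⟩ := Function.ne_iff.1 hγ0
    by_cases hαk : α' k = 0
    · obtain ⟨p, hp, h1, h2⟩ := ((frequently_zero_iff ({i, k} : Set (Fin n))).and_eventually
        (hγ.and hu')).exists
      simp only [mon_eq_zero i ((hp i).2 (by simp)) hβi, zero_mul, sub_zero,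
        mon_eq_zero k ((hp k).2 (by simp)) hk] at h1
      refine mul_ne_zero (mon_ne_zero fun l hl => ?_) h2 h1
      rcases (hp l).1 hl with rfl | rfl <;> assumption
    · have hβk : β' k = 0 := (hαβ k).resolve_left hαk
      obtain ⟨p, hp, h1, h2⟩ := ((frequently_zero_iff ({j, k} : Set (Fin n))).and_eventually
        (hγ.and hv')).exists
      simp only [mon_eq_zero j ((hp j).2 (by simp)) hαj, zero_mul, zero_sub,
        mon_eq_zero k ((hp k).2 (by simp)) hk, neg_eq_zero] at h1
      refine mul_ne_zero (mon_ne_zero fun l hl => ?_) h2 h1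
      rcases (hp l).1 hl with rfl | rfl <;> assumption

theorem analyticAt_update {E : Type*} [NormedAddCommGroup E] [NormedSpace ℝ E] {m : ℕ}
    {f : E → Fin m → ℝ} {g : E → ℝ} {a : E} (hf : AnalyticAt ℝ f a) (hg : AnalyticAt ℝ g a)
    (k : Fin m) : AnalyticAt ℝ (fun p => Function.update (f p) k (g p)) a := by
  rw [analyticAt_pi_iff] at hf ⊢
  intro j
  by_cases hj : j = k
  · subst hj; simpa using hg
  · simpa [hj] using hf j

theorem analyticAt_cons {E : Type*} [NormedAddCommGroup E] [NormedSpace ℝ E] {m : ℕ}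
    {f : E → Fin m → ℝ} {g : E → ℝ} {a : E} (hf : AnalyticAt ℝ f a) (hg : AnalyticAt ℝ g a) :
    AnalyticAt ℝ (fun p => (Fin.cons (g p) (f p) : Fin (m + 1) → ℝ)) a := by
  rw [analyticAt_pi_iff] at hf ⊢
  refine Fin.cases ?_ fun j => ?_
  · simpa using hg
  · simpa using hf j

theorem analyticAt_tail {m : ℕ} (a : Fin (m + 1) → ℝ) :
    AnalyticAt ℝ (fun p : Fin (m + 1) → ℝ => Fin.tail p) a := by
  rw [analyticAt_pi_iff]
  intro j
  exact analyticAt_coord j.succ a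

theorem tail_zero {m : ℕ} : Fin.tail (0 : Fin (m + 1) → ℝ) = 0 := rfl

theorem cons_zero_zero {m : ℕ} : (Fin.cons (0 : ℝ) (0 : Fin m → ℝ) : Fin (m + 1) → ℝ) = 0 := by
  ext j; refine Fin.cases ?_ (fun j => ?_) j <;> simp

theorem tendsto_tail {m : ℕ} :
    Tendsto (fun p : Fin (m + 1) → ℝ => Fin.tail p) (𝓝 0) (𝓝 0) :=
  (analyticAt_tail (0 : Fin (m + 1) → ℝ)).continuousAt

theorem AnalyticAt.comp_tail {m : ℕ} {f : (Fin m → ℝ) → ℝ} (hf : AnalyticAt ℝ f 0) :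
    AnalyticAt ℝ (fun p : Fin (m + 1) → ℝ => f (Fin.tail p)) 0 :=
  _root_.AnalyticAt.comp (g := f) hf (analyticAt_tail 0)

theorem eventuallyEq_zero_of_comp_tail {m : ℕ} {f : (Fin m → ℝ) → ℝ}
    (h : ∀ᶠ p in 𝓝 (0 : Fin (m + 1) → ℝ), f (Fin.tail p) = 0) : f =ᶠ[𝓝 0] 0 := by
  have : Tendsto (fun w : Fin m → ℝ => (Fin.cons (0 : ℝ) w : Fin (m + 1) → ℝ)) (𝓝 0) (𝓝 0) := by
    have := (analyticAt_cons (E := Fin m → ℝ) (analyticAt_id (z := 0))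
      (analyticAt_const (v := (0 : ℝ)))).continuousAt.tendsto
    simpa [cons_zero_zero] using this
  filter_upwards [this.eventually h] with w hw
  simpa using hw

theorem eventuallyEq_zero_of_section {m : ℕ} {π : (Fin m → ℝ) → Fin m → ℝ}
    (hπ : AnalyticAt ℝ π 0) (hπ0 : π 0 = 0)
    (h : ∃ᶠ p in 𝓝 (0 : Fin m → ℝ), ∃ σ : (Fin m → ℝ) → Fin m → ℝ, ContinuousAt σ (π p) ∧
      σ (π p) = p ∧ ∀ᶠ q in 𝓝 (π p), π (σ q) = q)
    {f : (Fin m → ℝ) → ℝ} (hf : AnalyticAt ℝ f 0) (hfπ : ∀ᶠ p in 𝓝 0, f (π p) = 0) :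
    f =ᶠ[𝓝 0] 0 := by
  have h1 : ∀ᶠ p in 𝓝 (0 : Fin m → ℝ), (f =ᶠ[𝓝 (π p)] 0 → f =ᶠ[𝓝 0] 0) := by
    refine hπ.continuousAt.eventually (p := fun q => f =ᶠ[𝓝 q] 0 → f =ᶠ[𝓝 0] 0) ?_
    rw [hπ0]
    exact eventually_eventuallyEq_zero_imp hf
  obtain ⟨p, ⟨σ, hσ, hσp, hs⟩, h2, h3⟩ := (h.and_eventually
    (h1.and (eventually_eventually_nhds.2 hfπ))).exists
  refine h2 ?_
  rw [← hσp] at h3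
  filter_upwards [hs, hσ.eventually h3] with q hq1 hq2
  rw [hq1] at hq2
  exact hq2

variable {ι : Type*} {U : Ultrafilter ι} {m : ℕ}

/-- `π` is an analytic germ fixing the origin, along which analytic germs pull back injectively,
and `y` lifts the family `x` along `π`. -/
structure Adm (U : Ultrafilter ι) (x y : ι → Fin m → ℝ) (π : (Fin m → ℝ) → Fin m → ℝ) : Prop where
  analyticAt : AnalyticAt ℝ π 0
  map_zero : π 0 = 0
  tendsto : Tendsto y U (𝓝 0)
  lift : ∀ᶠ i in (U : Filter ι), π (y i) = x i
  dominant : ∀ f : (Fin m → ℝ) → ℝ, AnalyticAt ℝ f 0 → (∀ᶠ p in 𝓝 0, f (π p) = 0) → f =ᶠ[𝓝 0] 0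

namespace Adm

variable {x y z : ι → Fin m → ℝ} {π ρ : (Fin m → ℝ) → Fin m → ℝ}

theorem refl (hx : Tendsto x U (𝓝 0)) : Adm U x x (fun p => p) :=
  ⟨analyticAt_id, rfl, hx, Eventually.of_forall fun _ => rfl, fun _ _ h => h⟩

theorem tendsto_zero (h : Adm U x y π) : Tendsto π (𝓝 0) (𝓝 0) := by
  simpa [h.map_zero] using h.analyticAt.continuousAt.tendsto

theorem analyticAt_comp (h : Adm U x y π) {F : Type*} [NormedAddCommGroup F] [NormedSpace ℝ F]
    {f : (Fin m → ℝ) → F} (hf : AnalyticAt ℝ f 0) :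
    AnalyticAt ℝ (fun p => f (π p)) 0 :=
  _root_.AnalyticAt.comp (g := f) (by rwa [h.map_zero]) h.analyticAt

theorem trans (h : Adm U x y π) (h' : Adm U y z ρ) : Adm U x z (fun p => π (ρ p)) where
  analyticAt := h'.analyticAt_comp h.analyticAt
  map_zero := by rw [h'.map_zero, h.map_zero]
  tendsto := h'.tendsto
  lift := by
    filter_upwards [h.lift, h'.lift] with i h1 h2
    rw [h2, h1]
  dominant f hf hfπ := h.dominant f hf (h'.dominant _ (h.analyticAt_comp hf) hfπ)

theorem not_eventually_zero (h : Adm U x y π) {f : (Fin m → ℝ) → ℝ} (hf : AnalyticAt ℝ f 0)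
    (hne : ¬ f =ᶠ[𝓝 0] 0) : ¬ (fun p => f (π p)) =ᶠ[𝓝 0] 0 :=
  fun h0 => hne (h.dominant f hf h0)

theorem affine (k : Fin m) {A B : (Fin m → ℝ) → ℝ} (hA : AnalyticAt ℝ A 0)
    (hB : AnalyticAt ℝ B 0) (hA0 : A 0 = 0)
    (hAk : ∀ p t, A (Function.update p k t) = A p) (hBk : ∀ p t, B (Function.update p k t) = B p)
    (hBne : ¬ B =ᶠ[𝓝 0] 0) (hx : Tendsto x U (𝓝 0)) {q : ι → ℝ} (hq : Tendsto q U (𝓝 0))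
    (hxq : ∀ᶠ i in (U : Filter ι), x i k = A (x i) + B (x i) * q i) :
    Adm U x (fun i => Function.update (x i) k (q i))
      (fun p => Function.update p k (A p + B p * p k)) := by
  have hana : AnalyticAt ℝ (fun p : Fin m → ℝ => Function.update p k (A p + B p * p k)) 0 :=
    analyticAt_update analyticAt_id (hA.add (hB.mul (analyticAt_coord k 0))) k
  have h0 : (fun p : Fin m → ℝ => Function.update p k (A p + B p * p k)) 0 = 0 := by
    simp [hA0]
  refine ⟨hana, h0, ?_, ?_, fun f hf hfπ => ?_⟩
  · have : Tendsto (fun i => Function.update (x i) k (q i)) U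
        (𝓝 (Function.update (0 : Fin m → ℝ) k 0)) := hx.update k hq
    simpa using this
  · filter_upwards [hxq] with i hi
    ext j
    by_cases hj : j = k
    · subst hj; simp [hAk, hBk, hi]
    · simp [hj]
  · refine eventuallyEq_zero_of_section hana h0 ?_ hf hfπ
    have h1 : ∃ᶠ p in 𝓝 (0 : Fin m → ℝ), B p ≠ 0 := fun h => hBne (by
      filter_upwards [h] with p hp
      simpa using hp)
    have hsA : Tendsto (fun p : Fin m → ℝ => Function.update p k (A p + B p * p k)) (𝓝 0) (𝓝 0) := by
      simpa [hA0] using hana.continuousAt.tendsto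
    refine (h1.and_eventually (hsA.eventually
      (hA.eventually_analyticAt.and hB.eventually_analyticAt))).mono ?_
    rintro p ⟨hp, hp1, hp2⟩
    have hBp : B (Function.update p k (A p + B p * p k)) ≠ 0 := by rwa [hBk]
    refine ⟨fun q => Function.update q k ((q k - A q) / B q), ?_, ?_, ?_⟩
    · exact continuousAt_id.update k
        (((continuousAt_apply k _).sub hp1.continuousAt).div hp2.continuousAt hBp)
    · ext j
      by_cases hj : j = k
      · subst hj
        simp [hAk, hBk, hp]
      · simp [hj]
    · filter_upwards [hp2.continuousAt.eventually_ne hBp] with q hq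
      ext j
      by_cases hj : j = k
      · subst hj
        simp [hAk, hBk]
        field_simp
        ring
      · simp [hj]

theorem of_equiv (e : (Fin m → ℝ) ≃L[ℝ] (Fin m → ℝ)) (hx : Tendsto x U (𝓝 0)) :
    Adm U x (fun i => e.symm (x i)) (fun p => e p) where
  analyticAt := e.analyticAt 0
  map_zero := by simp
  tendsto := by
    have := (e.symm.continuous.tendsto 0).comp hx
    simpa [Function.comp_def] using this
  lift := by simp
  dominant f hf h := by
    have : Tendsto (fun p => e.symm p) (𝓝 0) (𝓝 0) := by
      simpa using e.symm.continuous.tendsto 0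
    filter_upwards [this.eventually h] with p hp
    simpa using hp

theorem power (hx : Tendsto x U (𝓝 0)) {N : ℕ} (hN : N ≠ 0) :
    ∃ (ε : Fin m → ℝ) (y : ι → Fin m → ℝ), (∀ k, ε k ≠ 0) ∧
      Adm U x y (fun p k => ε k * p k ^ N) := by
  have hε : ∀ k, ∃ ε : ℝ, (ε = 1 ∨ ε = -1) ∧ ∀ᶠ i in (U : Filter ι), ε * |x i k| = x i k := by
    intro k
    rcases U.em (fun i => 0 ≤ x i k) with h | h
    · refine ⟨1, Or.inl rfl, ?_⟩
      filter_upwards [h] with i hi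
      rw [abs_of_nonneg hi, one_mul]
    · refine ⟨-1, Or.inr rfl, ?_⟩
      filter_upwards [h] with i hi
      rw [abs_of_neg (not_le.1 hi)]; ring
  choose ε hε1 hε2 using hε
  have hε0 : ∀ k, ε k ≠ 0 := fun k => by rcases hε1 k with h | h <;> rw [h] <;> norm_num
  have hN' : (0 : ℝ) < (N : ℝ)⁻¹ := by positivity
  have hcont : Continuous fun t : ℝ => |t| ^ (N : ℝ)⁻¹ :=
    continuous_abs.rpow_const fun _ => Or.inr hN'.le
  have hpow : ∀ t : ℝ, (|t| ^ (N : ℝ)⁻¹) ^ N = |t| := fun t =>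
    Real.rpow_inv_natCast_pow (abs_nonneg t) hN
  have hana : AnalyticAt ℝ (fun (p : Fin m → ℝ) k => ε k * p k ^ N) 0 := by
    rw [analyticAt_pi_iff]
    intro k
    fun_prop
  have h0 : (fun (p : Fin m → ℝ) k => ε k * p k ^ N) 0 = 0 := by
    ext k; simp [hN]
  refine ⟨ε, fun i k => |x i k| ^ (N : ℝ)⁻¹, hε0, hana, h0, ?_, ?_, fun f hf hfπ => ?_⟩
  · rw [tendsto_pi_nhds] at hx ⊢
    intro k
    have := (hcont.tendsto 0).comp (hx k)
    simpa [Function.comp_def, Real.zero_rpow hN'.ne'] using this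
  · filter_upwards [eventually_all.2 hε2] with i hi
    ext k
    simp only [hpow, hi]
  · refine eventuallyEq_zero_of_section hana h0 ?_ hf hfπ
    have hpos : ∃ᶠ p in 𝓝 (0 : Fin m → ℝ), ∀ k, 0 < p k := by
      have h : Tendsto (fun t : ℝ => fun _ : Fin m => t) (𝓝[>] 0) (𝓝 0) := by
        rw [tendsto_pi_nhds]
        intro k
        exact tendsto_id.mono_left nhdsWithin_le_nhds
      refine h.frequently (Eventually.frequently ?_)
      filter_upwards [self_mem_nhdsWithin] with t ht k using ht
    refine hpos.mono fun p hp => ⟨fun q k => |q k| ^ (N : ℝ)⁻¹, ?_, ?_, ?_⟩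
    · exact (continuous_pi fun k => hcont.comp (continuous_apply k)).continuousAt
    · ext k
      have : |ε k| = 1 := by rcases hε1 k with h | h <;> rw [h] <;> norm_num
      simp only [abs_mul, this, one_mul, abs_pow, abs_of_pos (hp k)]
      exact Real.pow_rpow_inv_natCast (hp k).le hN
    · have : ∀ k, ∀ᶠ q in 𝓝 (fun k => ε k * p k ^ N), ε k * |q k| = q k := by
        intro k
        have hc : Tendsto (fun q : Fin m → ℝ => q k) (𝓝 (fun k => ε k * p k ^ N))
          (𝓝 (ε k * p k ^ N)) := (continuous_apply k).tendsto _
        have hpk : 0 < p k ^ N := pow_pos (hp k) N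
        rcases hε1 k with h | h
        · rw [h] at hc ⊢
          filter_upwards [hc.eventually_const_lt (u := 0) (by simpa using hpk)] with q hq
          rw [abs_of_pos hq, one_mul]
        · rw [h] at hc ⊢
          filter_upwards [hc.eventually_lt_const (u := 0) (by simpa using hpk)] with q hq
          rw [abs_of_neg hq]; ring
      filter_upwards [eventually_all.2 this] with q hq
      ext k
      simp only [hpow, hq]

theorem cons {x y : ι → Fin m → ℝ} {π : (Fin m → ℝ) → Fin m → ℝ} (h : Adm U x y π) {t : ι → ℝ}
    (ht : Tendsto t U (𝓝 0)) :
    Adm U (fun i => (Fin.cons (t i) (x i) : Fin (m + 1) → ℝ)) (fun i => Fin.cons (t i) (y i))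
      (fun p => Fin.cons (p 0) (π (Fin.tail p))) where
  analyticAt := analyticAt_cons
    (_root_.AnalyticAt.comp (g := π) h.analyticAt (analyticAt_tail 0)) (analyticAt_coord 0 0)
  map_zero := by simp [tail_zero, h.map_zero, cons_zero_zero]
  tendsto := by
    rw [tendsto_pi_nhds]
    refine Fin.cases ?_ fun j => ?_
    · simpa using ht
    · simpa using tendsto_pi_nhds.1 h.tendsto j
  lift := by
    filter_upwards [h.lift] with i hi
    simp [hi]
  dominant f hf hfπ := by
    obtain ⟨r, hr, hball⟩ := Metric.eventually_nhds_iff_ball.1 hf.eventually_analyticAt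
    obtain ⟨δ, hδ, hz⟩ := Metric.eventually_nhds_iff_ball.1 hfπ
    have hmem : ∀ (t : ℝ) (w : Fin m → ℝ) (s : ℝ), |t| < s → w ∈ Metric.ball 0 s →
        (Fin.cons t w : Fin (m + 1) → ℝ) ∈ Metric.ball 0 s := by
      intro t w s ht hw
      have hs : 0 < s := (abs_nonneg t).trans_lt ht
      rw [mem_ball_zero_iff, pi_norm_lt_iff hs] at hw ⊢
      refine Fin.cases ?_ fun j => ?_
      · simpa using ht
      · simpa using hw j
    have key : ∀ t : ℝ, |t| < min r δ → ∀ w ∈ Metric.ball (0 : Fin m → ℝ) r,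
        f (Fin.cons t w) = 0 := by
      intro t ht
      have hon : AnalyticOnNhd ℝ (fun w : Fin m → ℝ => f (Fin.cons t w)) (Metric.ball 0 r) := by
        intro w hw
        exact _root_.AnalyticAt.comp (g := f) (hball _ (hmem t w r (lt_min_iff.1 ht).1 hw))
          (analyticAt_cons analyticAt_id analyticAt_const)
      have hz0 : (fun w : Fin m → ℝ => f (Fin.cons t w)) =ᶠ[𝓝 0] 0 := by
        refine h.dominant _ (hon 0 (Metric.mem_ball_self hr)) ?_
        filter_upwards [Metric.ball_mem_nhds 0 hδ] with w hw
        simpa using hz _ (hmem t w δ (lt_min_iff.1 ht).2 hw)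
      exact hon.eqOn_zero_of_preconnected_of_eventuallyEq_zero
        (convex_ball _ _).isPreconnected (Metric.mem_ball_self hr) hz0
    filter_upwards [Metric.ball_mem_nhds (0 : Fin (m + 1) → ℝ) (lt_min hr hδ)] with p hp
    rw [mem_ball_zero_iff] at hp
    have := key (p 0) ((norm_le_pi_norm p 0).trans_lt hp) (Fin.tail p) (by
      rw [mem_ball_zero_iff, pi_norm_lt_iff hr]
      intro j
      exact ((norm_le_pi_norm p j.succ).trans_lt hp).trans_le (min_le_left _ _))
    simpa using this

end Adm

variable {ι : Type*} {U : Ultrafilter ι} {n : ℕ}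

theorem ultrafilter_tendsto_of_abs_le {q : ι → ℝ} {C : ℝ}
    (h : ∀ᶠ i in (U : Filter ι), |q i| ≤ C) : ∃ c, Tendsto q U (𝓝 c) := by
  have hK : IsCompact (Set.Icc (-C) C) := isCompact_Icc
  obtain ⟨c, -, hc⟩ := hK.ultrafilter_le_nhds (U.map q) (by
    rw [le_principal_iff]
    change ∀ᶠ i in (U : Filter ι), q i ∈ Set.Icc (-C) C
    filter_upwards [h] with i hi using abs_le.1 hi)
  exact ⟨c, hc⟩

theorem ratio_dichotomy (a b : ι → ℝ) :
    (∃ (c : ℝ) (q : ι → ℝ), Tendsto q U (𝓝 c) ∧ ∀ᶠ i in (U : Filter ι), a i = b i * q i) ∨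
      ∃ r : ι → ℝ, Tendsto r U (𝓝 0) ∧ ∀ᶠ i in (U : Filter ι), b i = a i * r i := by
  by_cases h : ∃ C : ℝ, ∀ᶠ i in (U : Filter ι), |a i| ≤ C * |b i|
  · left
    obtain ⟨C, hC⟩ := h
    have hq : ∀ᶠ i in (U : Filter ι), |a i / b i| ≤ |C| := by
      filter_upwards [hC] with i hi
      rw [abs_div]
      refine div_le_of_le_mul₀ (abs_nonneg _) (abs_nonneg _) (hi.trans ?_)
      gcongr
      exact le_abs_self C
    obtain ⟨c, hc⟩ := ultrafilter_tendsto_of_abs_le hq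
    refine ⟨c, _, hc, ?_⟩
    filter_upwards [hC] with i hi
    by_cases hb : b i = 0
    · simp only [hb, abs_zero, mul_zero, abs_nonpos_iff] at hi
      simp [hb, hi]
    · field_simp
  · right
    push Not at h
    refine ⟨fun i => b i / a i, ?_, ?_⟩
    · rw [tendsto_zero_iff_abs_tendsto_zero, Metric.tendsto_nhds]
      intro ε hε
      filter_upwards [h ε⁻¹, h 0] with i hi hi0
      rw [zero_mul] at hi0
      simp only [Function.comp_apply, Real.dist_eq, sub_zero, abs_abs, abs_div]
      rw [div_lt_iff₀ hi0]
      rwa [inv_mul_lt_iff₀ hε] at hi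
    · filter_upwards [h 0] with i hi
      have : a i ≠ 0 := by
        rw [zero_mul] at hi
        exact abs_pos.1 hi
      field_simp

theorem mon_update_tail_zero (γ : Fin n → ℕ) (p : Fin (n + 1) → ℝ) (t : ℝ) :
    mon γ (Fin.tail (Function.update p 0 t)) = mon γ (Fin.tail p) := by simp

theorem analyticAt_mon_tail (γ : Fin n → ℕ) (p : Fin (n + 1) → ℝ) :
    AnalyticAt ℝ (fun p : Fin (n + 1) → ℝ => mon γ (Fin.tail p)) p :=
  AnalyticAt.comp (g := mon γ) (analyticAt_mon γ _) (analyticAt_tail p)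

/-- The substitution `z = w ^ γ * (c + ζ)`. -/
theorem Adm.blowFirst {x : ι → Fin (n + 1) → ℝ} (hx : Tendsto x U (𝓝 0)) {γ : Fin n → ℕ}
    {c : ℝ} (hγ : mon γ 0 * c = 0) {q : ι → ℝ} (hq : Tendsto q U (𝓝 c))
    (hxq : ∀ᶠ i in (U : Filter ι), x i 0 = mon γ (Fin.tail (x i)) * q i) :
    Adm U x (fun i => Function.update (x i) 0 (q i - c))
      (fun p => Function.update p 0 (mon γ (Fin.tail p) * (c + p 0))) := by
  have hne : ¬ (fun p : Fin (n + 1) → ℝ => mon γ (Fin.tail p)) =ᶠ[𝓝 0] 0 := fun h =>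
    (isNormalCrossing_mon γ).not_eventually_zero (eventuallyEq_zero_of_comp_tail h)
  have := Adm.affine (U := U) (x := x) 0 (A := fun p => mon γ (Fin.tail p) * c)
    (B := fun p => mon γ (Fin.tail p)) ((analyticAt_mon_tail γ 0).mul analyticAt_const)
    (analyticAt_mon_tail γ 0) (by simpa [tail_zero] using hγ) (by simp) (by simp) hne hx
    (q := fun i => q i - c) (by simpa using hq.sub_const c) (by
      filter_upwards [hxq] with i hi
      rw [hi]; ring)
  simpa only [mul_add] using this

/-- The substitution `w_j = z * w_j`. -/
theorem Adm.blowSucc {x : ι → Fin (n + 1) → ℝ} (hx : Tendsto x U (𝓝 0)) (j : Fin n)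
    {q : ι → ℝ} (hq : Tendsto q U (𝓝 0))
    (hxq : ∀ᶠ i in (U : Filter ι), x i j.succ = x i 0 * q i) :
    Adm U x (fun i => Function.update (x i) j.succ (q i))
      (fun p => Function.update p j.succ (p 0 * p j.succ)) := by
  have := Adm.affine (U := U) (x := x) j.succ (A := fun _ => 0) (B := fun p => p 0)
    analyticAt_const (analyticAt_coord 0 0) rfl (by simp)
    (fun p t => by simp [Function.update_of_ne (Fin.succ_ne_zero j).symm])
    (isNormalCrossing_coord 0).not_eventually_zero hx hq (by simpa using hxq)
  simpa using this

theorem isNormalCrossing_update {f : (Fin n → ℝ) → ℝ} (k : Fin n) (hf : IsNormalCrossing f)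
    (j : Fin n) : IsNormalCrossing (fun p => Function.update p k (f p) j) := by
  by_cases hj : j = k
  · subst hj; simpa using hf
  · simpa [hj] using isNormalCrossing_coord j

/-- If the monomial `w ^ γ` is infinitesimal relative to `z` along the ultrafilter, then after a
monomial transformation `z` divides `w ^ γ`. -/
theorem exists_adm_dvd {γ : Fin n → ℕ} {x : ι → Fin (n + 1) → ℝ} (hx : Tendsto x U (𝓝 0))
    {r : ι → ℝ} (hr : Tendsto r U (𝓝 0))
    (hxr : ∀ᶠ i in (U : Filter ι), mon γ (Fin.tail (x i)) = x i 0 * r i) :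
    ∃ y π s, Adm U x y π ∧ (∀ k, IsNormalCrossing (fun p => π p k)) ∧ AnalyticAt ℝ s 0 ∧
      s 0 = 0 ∧ ∀ᶠ p in 𝓝 0, mon γ (Fin.tail (π p)) = π p 0 * s p := by
  induction hN : ∑ k, γ k using Nat.strong_induction_on generalizing γ x r with
  | _ N ih =>
  have hx0 : Tendsto (fun i => x i 0) U (𝓝 0) := tendsto_pi_nhds.1 hx 0
  by_cases hγ : γ = 0
  · exfalso
    have h1 : Tendsto (fun i => x i 0 * r i) U (𝓝 (0 * 0)) := hx0.mul hr
    have h2 : Tendsto (fun i => x i 0 * r i) U (𝓝 1) := by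
      refine tendsto_const_nhds.congr' ?_
      filter_upwards [hxr] with i hi
      rw [← hi, hγ, mon_zero]
    simpa using tendsto_nhds_unique h1 h2
  obtain ⟨j, hj⟩ := Function.ne_iff.1 hγ
  obtain ⟨γ', rfl, hlt⟩ := exists_eq_add_single hj
  have hmon : ∀ p : Fin (n + 1) → ℝ, mon (Pi.single j 1 + γ') (Fin.tail p) =
      p j.succ * mon γ' (Fin.tail p) := fun p => by rw [mon_add, mon_single]; rfl
  simp only [hmon] at hxr ⊢
  have caseI : ∀ r' : ι → ℝ, Tendsto r' U (𝓝 0) →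
      (∀ᶠ i in (U : Filter ι), x i j.succ = x i 0 * r' i) →
      ∃ y π s, Adm U x y π ∧ (∀ k, IsNormalCrossing (fun p => π p k)) ∧ AnalyticAt ℝ s 0 ∧
        s 0 = 0 ∧ ∀ᶠ p in 𝓝 0, π p j.succ * mon γ' (Fin.tail (π p)) = π p 0 * s p := by
    intro r' hr' hxr'
    have hA := Adm.blowSucc hx j hr' hxr'
    refine ⟨_, _, fun p => p j.succ *
        mon γ' (Fin.tail (Function.update p j.succ (p 0 * p j.succ))),
      hA, isNormalCrossing_update _ ((isNormalCrossing_coord 0).mul (isNormalCrossing_coord _)),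
      ?_, by simp, ?_⟩
    · exact (analyticAt_coord _ _).mul (hA.analyticAt_comp (analyticAt_mon_tail γ' 0))
    · refine Eventually.of_forall fun p => ?_
      simp only [Function.update_self, Function.update_of_ne (Fin.succ_ne_zero j).symm]
      ring
  rcases ratio_dichotomy (U := U) (fun i => x i 0) (fun i => x i j.succ) with
    ⟨c, q, hq, hxq⟩ | ⟨r', hr', hxr'⟩
  swap
  · exact caseI r' hr' hxr'
  by_cases hγ' : γ' = 0
  · subst hγ'
    exact caseI r hr (by simpa using hxr)
  rcases U.em (fun i => x i j.succ = 0) with hz | hz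
  · refine caseI (fun _ => 0) tendsto_const_nhds ?_
    filter_upwards [hz] with i hi
    simp [hi]
  have hmono : mon (Pi.single j 1) (0 : Fin n → ℝ) = 0 := by simp [mon_single]
  have hA := Adm.blowFirst (U := U) hx (γ := Pi.single j 1) (c := c) (by simp [hmono]) hq (by
    simp only [mon_single]
    exact hxq)
  simp only [mon_single] at hA
  change Adm U x _ (fun p => Function.update p 0 (p j.succ * (c + p 0))) at hA
  by_cases hc : c = 0
  · subst hc
    simp only [zero_add, sub_zero] at hA
    obtain ⟨y, π, s, hπ, hNC, hs, hs0, hsπ⟩ := ih _ (hN ▸ hlt) (γ := γ') hA.tendsto hr (by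
      filter_upwards [hz, hxq, hxr] with i h1 h2 h3
      rw [mon_update_tail_zero, Function.update_self]
      rw [h2] at h3
      exact mul_left_cancel₀ h1 (by linarith)) rfl
    refine ⟨y, _, s, hA.trans hπ, fun k => ?_, hs, hs0, ?_⟩
    · exact (isNormalCrossing_update (f := fun p => p j.succ * p 0) 0
        ((isNormalCrossing_coord _).mul (isNormalCrossing_coord _)) k).comp
        hπ.analyticAt hπ.map_zero hNC
    · filter_upwards [hsπ] with p hp
      rw [mon_update_tail_zero, Function.update_self,
        Function.update_of_ne (Fin.succ_ne_zero j), hp]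
      ring
  · have hunit : AnalyticAt ℝ (fun p : Fin (n + 1) → ℝ => c + p 0) 0 := by fun_prop
    have hunit0 : (fun p : Fin (n + 1) → ℝ => c + p 0) 0 ≠ 0 := by simpa using hc
    refine ⟨_, _, fun p => mon γ' (Fin.tail p) / (c + p 0), hA, isNormalCrossing_update _
      ((isNormalCrossing_coord _).mul (isNormalCrossing_of_ne_zero hunit hunit0)),
      (analyticAt_mon_tail γ' 0).div hunit hunit0, by simp [tail_zero, mon_at_zero hγ'], ?_⟩
    filter_upwards [hunit.continuousAt.eventually_ne hunit0] with p hp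
    rw [mon_update_tail_zero, Function.update_self, Function.update_of_ne (Fin.succ_ne_zero j)]
    field_simp

open scoped ContDiff

variable {n : ℕ}

theorem coeff_eq_zero_of_eq_pow_mul {d : ℕ} {a : ℕ → ℝ} {v : ℝ → ℝ} (hv : ContinuousAt v 0)
    (h : ∀ᶠ t in 𝓝[≠] (0 : ℝ), ∑ i ∈ Finset.range d, a i * t ^ i = t ^ d * v t) :
    ∀ i < d, a i = 0 := by
  induction d generalizing a v with
  | zero => simp
  | succ d ih =>
    have h0 : a 0 = 0 := by
      have h1 : Tendsto (fun t : ℝ => ∑ i ∈ Finset.range (d + 1), a i * t ^ i) (𝓝[≠] 0)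
          (𝓝 (∑ i ∈ Finset.range (d + 1), a i * 0 ^ i)) :=
        (Continuous.tendsto (by fun_prop) 0).mono_left nhdsWithin_le_nhds
      have h2 : Tendsto (fun t : ℝ => t ^ (d + 1) * v t) (𝓝[≠] 0) (𝓝 (0 ^ (d + 1) * v 0)) :=
        (((continuous_pow (d + 1)).continuousAt.mul hv).tendsto).mono_left nhdsWithin_le_nhds
      have h3 := tendsto_nhds_unique (h2.congr' (h.mono fun t ht => ht.symm)) h1
      rw [Finset.sum_range_succ'] at h3
      simpa using h3.symm
    have h1 := ih (a := fun i => a (i + 1)) hv (by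
      filter_upwards [h, self_mem_nhdsWithin] with t ht ht0
      have ht0 : t ≠ 0 := ht0
      rw [Finset.sum_range_succ', h0] at ht
      refine mul_left_cancel₀ ht0 ?_
      rw [Finset.mul_sum, ← mul_assoc, ← pow_succ', ← ht]
      simp only [zero_mul, add_zero]
      exact Finset.sum_congr rfl fun i _ => by ring)
    intro i hi
    cases i with
    | zero => exact h0
    | succ i => exact h1 i (by omega)

theorem iteratedDeriv_eq_of_expansion {d : ℕ} {a : ℕ → ℝ} {v f : ℝ → ℝ} (hf : AnalyticAt ℝ f 0)
    (hv : ContinuousAt v 0)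
    (h : ∀ᶠ t in 𝓝 (0 : ℝ), f t = ∑ i ∈ Finset.range d, a i * t ^ i + t ^ d * v t) :
    ∀ i < d, iteratedDeriv i f 0 = i.factorial * a i := by
  obtain ⟨F, hF, hFf⟩ := hf.exists_eventuallyEq_sum_add_pow_mul d
  have := coeff_eq_zero_of_eq_pow_mul (d := d) (a := fun i => a i - iteratedDeriv i f 0 / i.factorial)
    (v := fun t => F t - v t) (hF.continuousAt.sub hv) (by
      refine Filter.Eventually.filter_mono nhdsWithin_le_nhds ?_
      filter_upwards [h, hFf] with t h1 h2
      have h3 : ∑ i ∈ Finset.range d, (t ^ i / i.factorial) • iteratedDeriv i f 0 =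
          ∑ i ∈ Finset.range d, iteratedDeriv i f 0 / i.factorial * t ^ i :=
        Finset.sum_congr rfl fun i _ => by simp only [smul_eq_mul]; ring
      rw [h3, smul_eq_mul] at h2
      simp only [sub_mul, Finset.sum_sub_distrib]
      linarith)
  intro i hi
  have h4 := this i hi
  have : (i.factorial : ℝ) ≠ 0 := by positivity
  field_simp at h4
  linarith

theorem exists_expansion {f : (Fin (n + 1) → ℝ) → ℝ} (hf : AnalyticAt ℝ f 0) (d : ℕ) :
    ∃ (c : ℕ → (Fin n → ℝ) → ℝ) (u : (Fin (n + 1) → ℝ) → ℝ), (∀ i, AnalyticAt ℝ (c i) 0) ∧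
      AnalyticAt ℝ u 0 ∧ ∀ᶠ p in 𝓝 0,
        f p = ∑ i ∈ Finset.range d, c i (Fin.tail p) * p 0 ^ i + p 0 ^ d * u p := by
  induction d with
  | zero => exact ⟨fun _ _ => 0, f, fun _ => analyticAt_const, hf, by simp⟩
  | succ d ih =>
    obtain ⟨c, u, hc, hu, h⟩ := ih
    obtain ⟨g, hg, hug⟩ := exists_div_coord hu 0
    refine ⟨Function.update c d fun w => u (Fin.cons 0 w), g, fun i => ?_, hg, ?_⟩
    · by_cases hi : i = d
      · subst hi
        rw [Function.update_self]
        exact AnalyticAt.comp (g := u) (by rwa [cons_zero_zero])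
          (analyticAt_cons analyticAt_id analyticAt_const)
      · rw [Function.update_of_ne hi]; exact hc i
    · filter_upwards [h, hug] with p h1 h2
      have h3 : ∑ i ∈ Finset.range d, Function.update c d (fun w => u (Fin.cons 0 w)) i
          (Fin.tail p) * p 0 ^ i = ∑ i ∈ Finset.range d, c i (Fin.tail p) * p 0 ^ i :=
        Finset.sum_congr rfl fun i hi => by
          rw [Function.update_of_ne (Finset.mem_range.1 hi).ne]
      have h4 : Function.update p 0 0 = (Fin.cons 0 (Fin.tail p) : Fin (n + 1) → ℝ) := by
        rw [← Fin.cons_self_tail p, Fin.update_cons_zero]; simp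
      rw [Finset.sum_range_succ, h3, Function.update_self, h1, h2, h4]
      ring

/-- The derivative in the first coordinate. -/
noncomputable def dz (f : (Fin (n + 1) → ℝ) → ℝ) (p : Fin (n + 1) → ℝ) : ℝ :=
  fderiv ℝ f p (Pi.single 0 1)

theorem analyticAt_dz {f : (Fin (n + 1) → ℝ) → ℝ} {p : Fin (n + 1) → ℝ} (hf : AnalyticAt ℝ f p) :
    AnalyticAt ℝ (dz f) p := analyticAt_fderiv_apply hf _

theorem analyticAt_dz_iterate {f : (Fin (n + 1) → ℝ) → ℝ} {p : Fin (n + 1) → ℝ}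
    (hf : AnalyticAt ℝ f p) (k : ℕ) : AnalyticAt ℝ (dz^[k] f) p := by
  induction k generalizing f with
  | zero => exact hf
  | succ k ih => exact ih (analyticAt_dz hf)

theorem hasDerivAt_cons (w : Fin n → ℝ) (t : ℝ) :
    HasDerivAt (fun s : ℝ => (Fin.cons s w : Fin (n + 1) → ℝ)) (Pi.single 0 1) t := by
  rw [hasDerivAt_pi]
  refine Fin.cases ?_ fun j => ?_
  · simpa using hasDerivAt_id' t
  · simpa using hasDerivAt_const t (w j)

theorem analyticAt_slice {f : (Fin (n + 1) → ℝ) → ℝ} {t : ℝ} {w : Fin n → ℝ}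
    (hf : AnalyticAt ℝ f (Fin.cons t w)) : AnalyticAt ℝ (fun s : ℝ => f (Fin.cons s w)) t :=
  AnalyticAt.comp (g := f) hf (analyticAt_cons analyticAt_const analyticAt_id)

theorem iteratedDeriv_slice {f : (Fin (n + 1) → ℝ) → ℝ} {t : ℝ} {w : Fin n → ℝ}
    (hf : AnalyticAt ℝ f (Fin.cons t w)) (k : ℕ) :
    iteratedDeriv k (fun s : ℝ => f (Fin.cons s w)) t = (dz^[k] f) (Fin.cons t w) := by
  induction k generalizing f with
  | zero => simp
  | succ k ih =>
    rw [iteratedDeriv_succ', Function.iterate_succ_apply, ← ih (analyticAt_dz hf)]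
    refine Filter.EventuallyEq.iteratedDeriv_eq k ?_
    filter_upwards [(hasDerivAt_cons w t).continuousAt.eventually hf.eventually_analyticAt] with s hs
    exact (hs.differentiableAt.hasFDerivAt.comp_hasDerivAt s (hasDerivAt_cons w s)).deriv

theorem exists_implicit {G : (Fin (n + 1) → ℝ) → ℝ} (hG : AnalyticAt ℝ G 0) (hG0 : G 0 = 0)
    (hG1 : dz G 0 ≠ 0) : ∃ φ : (Fin n → ℝ) → ℝ, AnalyticAt ℝ φ 0 ∧ φ 0 = 0 ∧
      ∀ᶠ w in 𝓝 0, G (Fin.cons (φ w) w) = 0 := by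
  set g : (Fin n → ℝ) × ℝ → ℝ := fun v => G (Fin.cons v.2 v.1) with hg
  have hga : AnalyticAt ℝ g 0 :=
    AnalyticAt.comp (g := G) (by simpa [cons_zero_zero] using hG)
      (analyticAt_cons analyticAt_fst analyticAt_snd)
  have hone : (fderiv ℝ g 0 ∘L .inr ℝ (Fin n → ℝ) ℝ) 1 = dz G 0 := by
    have h1 : HasDerivAt (fun s : ℝ => ((0 : Fin n → ℝ), s)) (0, 1) 0 :=
      (hasDerivAt_const 0 _).prodMk (hasDerivAt_id 0)
    have h2 := (hga.differentiableAt.hasFDerivAt.comp_hasDerivAt (0 : ℝ) h1).deriv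
    have h3 := iteratedDeriv_slice (f := G) (t := 0) (w := 0) (by rwa [cons_zero_zero]) 1
    rw [iteratedDeriv_one, Function.iterate_one, cons_zero_zero] at h3
    rw [← h3]
    simpa [Function.comp_def, hg] using h2.symm
  have hinv : (fderiv ℝ g 0 ∘L .inr ℝ (Fin n → ℝ) ℝ).IsInvertible := by
    refine ⟨ContinuousLinearEquiv.unitsEquivAut ℝ (Units.mk0 _ hG1), ?_⟩
    ext
    rw [hone]
    simp
  have hcd : ContDiffAt ℝ ω g 0 := hga.contDiffAt
  have hω : (ω : WithTop ℕ∞) ≠ 0 := by simp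
  refine ⟨hcd.implicitFunction hω hinv, ?_, ?_, ?_⟩
  · exact (hcd.contDiffAt_implicitFunction hω hinv).analyticAt
  · exact hcd.implicitFunction_apply_self hω hinv
  · have h := hcd.eventually_apply_implicitFunction hω hinv
    have hg0 : g 0 = 0 := by simp [hg, cons_zero_zero, hG0]
    rw [hg0] at h
    exact h

/-- A shear kills the subleading coefficient in the expansion of a regular germ of order `d`. -/
theorem exists_tschirnhaus {f : (Fin (n + 1) → ℝ) → ℝ} (hf : AnalyticAt ℝ f 0) {d : ℕ}
    (hd : analyticOrderAt (fun t : ℝ => f (Fin.cons t 0)) 0 = (d + 1 : ℕ)) :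
    ∃ φ : (Fin n → ℝ) → ℝ, AnalyticAt ℝ φ 0 ∧ φ 0 = 0 ∧
      ∃ (c : ℕ → (Fin n → ℝ) → ℝ) (u : (Fin (n + 1) → ℝ) → ℝ), (∀ i, AnalyticAt ℝ (c i) 0) ∧
        AnalyticAt ℝ u 0 ∧ u 0 ≠ 0 ∧ (∀ i < d + 1, c i 0 = 0) ∧ c d =ᶠ[𝓝 0] 0 ∧
        ∀ᶠ p in 𝓝 0, f (Function.update p 0 (φ (Fin.tail p) + p 0)) =
          ∑ i ∈ Finset.range (d + 1), c i (Fin.tail p) * p 0 ^ i + p 0 ^ (d + 1) * u p := by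
  have hf0 : AnalyticAt ℝ f (Fin.cons 0 0) := by rwa [cons_zero_zero]
  have hs := analyticAt_slice hf0
  obtain ⟨hlt, hne⟩ := (analyticOrderAt_eq_nat_iff_iteratedDeriv_eq_zero hs).1 hd
  simp only [iteratedDeriv_slice hf0, cons_zero_zero] at hlt hne
  obtain ⟨φ, hφ, hφ0, hφG⟩ := exists_implicit (analyticAt_dz_iterate hf d) (hlt d (by omega))
    (by rwa [Function.iterate_succ_apply'] at hne)
  have hupd : ∀ (t : ℝ) (w : Fin n → ℝ), Function.update (Fin.cons t w : Fin (n + 1) → ℝ) 0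
      (φ (Fin.tail (Fin.cons t w : Fin (n + 1) → ℝ)) + (Fin.cons t w : Fin (n + 1) → ℝ) 0) =
      (Fin.cons (φ w + t) w : Fin (n + 1) → ℝ) := fun t w => by
    rw [Fin.update_cons_zero]; simp
  set π : (Fin (n + 1) → ℝ) → Fin (n + 1) → ℝ :=
    fun p => Function.update p 0 (φ (Fin.tail p) + p 0) with hπ
  have hπa : AnalyticAt ℝ π 0 := analyticAt_update analyticAt_id
    ((AnalyticAt.comp_tail hφ).add (analyticAt_coord 0 0)) 0
  have hπ0 : π 0 = 0 := by simp [hπ, tail_zero, hφ0]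
  have hfπ : AnalyticAt ℝ (fun p => f (π p)) 0 := AnalyticAt.comp (g := f) (by rwa [hπ0]) hπa
  obtain ⟨c, u, hc, hu, hcu⟩ := exists_expansion hfπ (d + 1)
  have hcons : Tendsto (fun w : Fin n → ℝ => (Fin.cons (0 : ℝ) w : Fin (n + 1) → ℝ)) (𝓝 0) (𝓝 0) := by
    simpa [cons_zero_zero] using (analyticAt_cons (E := Fin n → ℝ) (analyticAt_id (z := 0))
      (analyticAt_const (v := (0 : ℝ)))).continuousAt.tendsto
  have hsl : ∀ᶠ w in 𝓝 (0 : Fin n → ℝ), ∀ᶠ t in 𝓝 (0 : ℝ), f (Fin.cons (φ w + t) w) =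
      ∑ i ∈ Finset.range (d + 1), c i w * t ^ i + t ^ (d + 1) * u (Fin.cons t w) := by
    filter_upwards [hcons.eventually (eventually_eventually_nhds.2 hcu)] with w hw
    filter_upwards [(hasDerivAt_cons w 0).continuousAt.eventually hw] with t ht
    simpa only [hπ, hupd, Fin.cons_zero, Fin.tail_cons] using ht
  have hder : ∀ᶠ w in 𝓝 (0 : Fin n → ℝ), ∀ i < d + 1,
      (dz^[i] f) (Fin.cons (φ w) w) = i.factorial * c i w := by
    have hφt : Tendsto (fun w => (Fin.cons (φ w) w : Fin (n + 1) → ℝ)) (𝓝 0) (𝓝 0) := by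
      simpa [hφ0, cons_zero_zero] using (analyticAt_cons analyticAt_id hφ).continuousAt.tendsto
    filter_upwards [hsl, hcons.eventually hu.eventually_analyticAt,
      hφt.eventually hf.eventually_analyticAt] with w h1 h2 h3 i hi
    have h4 : AnalyticAt ℝ (fun t : ℝ => f (Fin.cons (φ w + t) w)) 0 :=
      AnalyticAt.comp (g := fun t : ℝ => f (Fin.cons t w)) (f := fun t => φ w + t)
        (by simpa using analyticAt_slice h3) (by fun_prop)
    have h5 := iteratedDeriv_eq_of_expansion h4 (analyticAt_slice h2).continuousAt h1 i hi
    rw [← h5, iteratedDeriv_comp_const_add i (fun t : ℝ => f (Fin.cons t w))]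
    simp only [add_zero]
    exact (iteratedDeriv_slice h3 i).symm
  have hc0 : ∀ i < d + 1, c i 0 = 0 := by
    intro i hi
    have := hder.self_of_nhds i hi
    rw [hφ0, cons_zero_zero, hlt i hi] at this
    have hfac : (i.factorial : ℝ) ≠ 0 := by positivity
    simpa [hfac] using this.symm
  refine ⟨φ, hφ, hφ0, c, u, hc, hu, ?_, hc0, ?_, hcu⟩
  · have h1 := hsl.self_of_nhds
    obtain ⟨g, hg, hg0, hgf⟩ := hs.analyticOrderAt_eq_natCast.1 hd
    simp only [hφ0, zero_add, sub_zero, smul_eq_mul] at h1 hgf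
    have hu' : AnalyticAt ℝ (fun t : ℝ => u (Fin.cons t 0)) 0 :=
      analyticAt_slice (by rwa [cons_zero_zero])
    have h2 : Tendsto (fun t : ℝ => u (Fin.cons t 0)) (𝓝[≠] 0) (𝓝 (u (Fin.cons 0 0))) :=
      hu'.continuousAt.tendsto.mono_left nhdsWithin_le_nhds
    have h3 : Tendsto g (𝓝[≠] 0) (𝓝 (g 0)) :=
      hg.continuousAt.tendsto.mono_left nhdsWithin_le_nhds
    have h4 := tendsto_nhds_unique (h2.congr' (f₂ := g) (by
      filter_upwards [h1.filter_mono nhdsWithin_le_nhds, hgf.filter_mono nhdsWithin_le_nhds,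
        self_mem_nhdsWithin] with t h5 h6 h7
      rw [Finset.sum_eq_zero (fun i hi => by rw [hc0 i (Finset.mem_range.1 hi), zero_mul]),
        zero_add, h6] at h5
      exact (mul_left_cancel₀ (pow_ne_zero _ h7) h5).symm)) h3
    rw [← cons_zero_zero, h4]
    exact hg0
  · filter_upwards [hder, hφG] with w h1 h2
    have := h1 d (by omega)
    rw [h2] at this
    have hfac : (d.factorial : ℝ) ≠ 0 := by positivity
    simpa [hfac] using this.symm

variable {ι : Type*} {U : Ultrafilter ι} {n : ℕ}

/-- Every nonzero analytic germ in `n` variables becomes normal crossing along `U` after an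
admissible substitution. -/
def Monomializes (U : Ultrafilter ι) (n : ℕ) : Prop :=
  ∀ x : ι → Fin n → ℝ, Tendsto x U (𝓝 0) → ∀ f : (Fin n → ℝ) → ℝ, AnalyticAt ℝ f 0 →
    ¬ f =ᶠ[𝓝 0] 0 → ∃ y π, Adm U x y π ∧ IsNormalCrossing (fun p => f (π p))

theorem mon_mul_pow (α : Fin n → ℕ) (ε p : Fin n → ℝ) (N : ℕ) :
    mon α (fun k => ε k * p k ^ N) = mon α ε * mon (N • α) p := by
  simp [mon, mul_pow, Finset.prod_mul_distrib, pow_mul]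

theorem exists_minimal_exponent {I : Finset ℕ} (hI : I.Nonempty) (β : ℕ → Fin n → ℕ)
    (hβ : ∀ i ∈ I, ∀ j ∈ I, β i ≤ β j ∨ β j ≤ β i) : ∃ i ∈ I, ∀ j ∈ I, β i ≤ β j := by
  obtain ⟨i, hi, hmin⟩ := I.exists_min_image (fun i => ∑ k, β i k) hI
  refine ⟨i, hi, fun j hj => (hβ i hi j hj).elim id fun h => ?_⟩
  intro k
  by_contra hk
  push Not at hk
  exact absurd (hmin j hj) (not_le.2 (Finset.sum_lt_sum (fun k _ => h k) ⟨k, Finset.mem_univ _, hk⟩))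

theorem exists_adm_newton (hP : Monomializes U n) {x : ι → Fin n → ℝ} (hx : Tendsto x U (𝓝 0))
    {h : (Fin n → ℝ) → ℝ} (hh : AnalyticAt ℝ h 0) (hh0 : ¬ h =ᶠ[𝓝 0] 0) {d : ℕ}
    {c : ℕ → (Fin n → ℝ) → ℝ} (hc : ∀ i, AnalyticAt ℝ (c i) 0) (hc0 : ∀ i < d, c i 0 = 0)
    (hI : ∃ i < d, ¬ c i =ᶠ[𝓝 0] 0) :
    ∃ y π γ, ∃ b : ℕ → (Fin n → ℝ) → ℝ, Adm U x y π ∧ IsNormalCrossing (fun p => h (π p)) ∧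
      γ ≠ 0 ∧ (∀ i, AnalyticAt ℝ (b i) 0) ∧ (∃ i < d, b i 0 ≠ 0) ∧
      (∀ i < d, c i =ᶠ[𝓝 0] 0 → b i 0 = 0) ∧
      ∀ i < d, ∀ᶠ w in 𝓝 0, c i (π w) = mon γ w ^ (d - i) * b i w := by
  classical
  set I := (Finset.range d).filter fun i => ¬ c i =ᶠ[𝓝 0] 0 with hIdef
  have hmemI : ∀ i, i ∈ I ↔ i < d ∧ ¬ c i =ᶠ[𝓝 0] 0 := fun i => by simp [hIdef]
  set N := d.factorial with hN
  set e : ℕ → ℕ := fun i => N / (d - i) with he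
  have heN : ∀ i < d, (d - i) * e i = N := fun i hi =>
    Nat.mul_div_cancel' (Nat.dvd_factorial (by omega) (by omega))
  have hN0 : N ≠ 0 := Nat.factorial_ne_zero d
  set D : ℕ × ℕ → (Fin n → ℝ) → ℝ := fun q w => c q.1 w ^ e q.1 - c q.2 w ^ e q.2 with hD
  have hDa : ∀ q, AnalyticAt ℝ (D q) 0 := fun q => ((hc _).pow _).sub ((hc _).pow _)
  set J := (I ×ˢ I).filter fun q => ¬ D q =ᶠ[𝓝 0] 0 with hJ
  have hca : AnalyticAt ℝ (fun w => ∏ i ∈ I, c i w) 0 :=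
    Finset.analyticAt_fun_prod _ fun i _ => hc i
  have hDp : AnalyticAt ℝ (fun w => ∏ q ∈ J, D q w) 0 :=
    Finset.analyticAt_fun_prod _ fun q _ => hDa q
  have hhc : AnalyticAt ℝ (fun w => h w * ∏ i ∈ I, c i w) 0 := hh.mul hca
  have hH : AnalyticAt ℝ (fun w => (h w * ∏ i ∈ I, c i w) * ∏ q ∈ J, D q w) 0 := hhc.mul hDp
  have hH0 : ¬ (fun w => (h w * ∏ i ∈ I, c i w) * ∏ q ∈ J, D q w) =ᶠ[𝓝 0] 0 := by
    intro h0
    rcases eventuallyEq_zero_or_of_mul hhc hDp h0 with h1 | h1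
    · rcases eventuallyEq_zero_or_of_mul hh hca h1 with h2 | h2
      · exact hh0 h2
      · exact not_eventually_zero_prod (fun i _ => hc i) (fun i hi => ((hmemI i).1 hi).2) h2
    · exact not_eventually_zero_prod (fun q _ => hDa q) (fun q hq => (Finset.mem_filter.1 hq).2) h1
  obtain ⟨y, π, hA, hNC⟩ := hP x hx _ hH hH0
  have hNC1 := hNC.left_of_mul (hA.analyticAt_comp hhc) (hA.analyticAt_comp hDp)
  have hNCD := hNC.right_of_mul (hA.analyticAt_comp hhc) (hA.analyticAt_comp hDp)
  have hNCh := hNC1.left_of_mul (hA.analyticAt_comp hh) (hA.analyticAt_comp hca)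
  have hNCc := hNC1.right_of_mul (hA.analyticAt_comp hh) (hA.analyticAt_comp hca)
  have hci : ∀ i ∈ I, ∃ (α : Fin n → ℕ) (u : (Fin n → ℝ) → ℝ), AnalyticAt ℝ u 0 ∧ u 0 ≠ 0 ∧
      ∀ᶠ w in 𝓝 0, c i (π w) = mon α w * u w := fun i hi =>
    IsNormalCrossing.of_prod (f := fun i w => c i (π w)) (fun i _ => hA.analyticAt_comp (hc i))
      hNCc hi
  choose! α v hv hv0 hcv using hci
  have hcomp : ∀ i ∈ I, ∀ j ∈ I, e i • α i ≤ e j • α j ∨ e j • α j ≤ e i • α i := by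
    intro i hi j hj
    have heq : ∀ᶠ w in 𝓝 0, mon (e i • α i) w * v i w ^ e i - mon (e j • α j) w * v j w ^ e j =
        D (i, j) (π w) := by
      filter_upwards [hcv i hi, hcv j hj] with w h1 h2
      simp only [hD, h1, h2, mul_pow, mon_smul]
    refine exponents_comparable ((hv i hi).pow (e i)) (pow_ne_zero _ (hv0 i hi))
      ((hv j hj).pow (e j)) (pow_ne_zero _ (hv0 j hj)) ?_
    by_cases hz : D (i, j) =ᶠ[𝓝 0] 0
    · left
      filter_upwards [heq, hA.tendsto_zero.eventually hz] with w h1 h2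
      simpa using h1.trans h2
    · right
      refine (IsNormalCrossing.of_prod (f := fun q w => D q (π w))
        (fun q _ => hA.analyticAt_comp (hDa q)) hNCD (i := (i, j)) ?_).congr heq
      exact Finset.mem_filter.2 ⟨Finset.mem_product.2 ⟨hi, hj⟩, hz⟩
  obtain ⟨i₀, hi₀, hmin⟩ := exists_minimal_exponent
    (by obtain ⟨i, hi⟩ := hI; exact ⟨i, (hmemI i).2 hi⟩) (fun i => e i • α i) hcomp
  have hi₀d := ((hmemI i₀).1 hi₀).1
  obtain ⟨ε, z, hε, hB⟩ := Adm.power hA.tendsto hN0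
  set ρ : (Fin n → ℝ) → Fin n → ℝ := fun p k => ε k * p k ^ N with hρ
  set γ := e i₀ • α i₀ with hγ
  set δ : ℕ → Fin n → ℕ := fun i => N • α i - (d - i) • γ with hδ
  have hle : ∀ i ∈ I, (d - i) • γ ≤ N • α i := fun i hi => by
    rw [← heN i ((hmemI i).1 hi).1, mul_smul]
    exact fun k => Nat.mul_le_mul_left _ (hmin i hi k)
  have hδi₀ : δ i₀ = 0 := by
    simp only [hδ, hγ]
    rw [← mul_smul, heN i₀ hi₀d, tsub_self]
  refine ⟨z, fun p => π (ρ p), γ,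
    fun i p => if i ∈ I then mon (δ i) p * (mon (α i) ε * v i (ρ p)) else 0,
    hA.trans hB, hNCh.comp hB.analyticAt hB.map_zero fun k => ?_, ?_, fun i => ?_,
    ⟨i₀, hi₀d, ?_⟩, fun i _ hi => ?_, fun i hi => ?_⟩
  · exact (isNormalCrossing_of_ne_zero (f := fun _ => ε k) analyticAt_const (hε k)).mul
      ((isNormalCrossing_coord k).pow N)
  · intro h0
    have hα : α i₀ = 0 := by
      have he0 : e i₀ ≠ 0 := fun h0 => hN0 (by rw [← heN i₀ hi₀d, h0, mul_zero])
      exact (smul_eq_zero.1 h0).resolve_left he0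
    have := (hcv i₀ hi₀).self_of_nhds
    rw [hα, mon_zero, one_mul, hA.map_zero, hc0 i₀ hi₀d] at this
    exact hv0 i₀ hi₀ this.symm
  · by_cases hi : i ∈ I
    · simp only [hi, if_true]
      exact (analyticAt_mon _ _).mul (analyticAt_const.mul (hB.analyticAt_comp (hv i hi)))
    · simp only [hi, if_false]
      exact analyticAt_const
  · simp only [hi₀, if_true, hδi₀, mon_zero, one_mul]
    rw [hB.map_zero]
    exact mul_ne_zero (mon_ne_zero fun k hk => absurd hk (hε k)) (hv0 i₀ hi₀)
  · have : i ∉ I := fun hiI => ((hmemI i).1 hiI).2 hi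
    simp [this]
  · by_cases hiI : i ∈ I
    · filter_upwards [hB.tendsto_zero.eventually (hcv i hiI)] with w hw
      have h1 : N • α i = (d - i) • γ + δ i := (add_tsub_cancel_of_le (hle i hiI)).symm
      rw [hw, hρ, mon_mul_pow, h1, mon_add, mon_smul]
      simp only [hiI, if_true]
      ring
    · have hz : c i =ᶠ[𝓝 0] 0 := by
        by_contra hz
        exact hiI ((hmemI i).2 ⟨hi, hz⟩)
      filter_upwards [(hA.trans hB).tendsto_zero.eventually hz] with w hw
      simpa [hiI] using hw

theorem exists_order_lt {d : ℕ} {b : ℕ → ℝ} {a c : ℝ} (ha : a ≠ 0) (hb : ∃ i < d + 1, b i ≠ 0)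
    (hbd : b d = 0) : ∃ k < d + 1, analyticOrderAt (fun t : ℝ =>
      ∑ i ∈ Finset.range (d + 1), b i * (c + t) ^ i + (c + t) ^ (d + 1) * a) 0 = (k : ℕ) := by
  open Polynomial in
  set P : ℝ[X] := ∑ i ∈ Finset.range (d + 1), C (b i) * X ^ i + C a * X ^ (d + 1) with hPdef
  have hcoeff : ∀ i < d + 1, P.coeff i = b i := fun i hi => by
    simp only [hPdef, Polynomial.coeff_add, Polynomial.finsetSum_coeff,
      Polynomial.coeff_C_mul_X_pow, Finset.sum_ite_eq, Finset.mem_range, hi, hi.ne, if_true,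
      if_false, add_zero]
  have hcoeff' : P.coeff (d + 1) = a := by
    simp [hPdef, Polynomial.coeff_X_pow]
  have hP0 : P ≠ 0 := fun h0 => ha (by rw [← hcoeff', h0, Polynomial.coeff_zero])
  have hdeg : P.natDegree ≤ d + 1 := by
    refine Polynomial.natDegree_add_le_of_degree_le ?_ (Polynomial.natDegree_C_mul_X_pow_le _ _)
    exact Polynomial.natDegree_sum_le_of_forall_le _ _ fun i hi =>
      (Polynomial.natDegree_C_mul_X_pow_le _ _).trans (Finset.mem_range.1 hi).le
  obtain ⟨Q, hQ, hQd⟩ := Polynomial.exists_eq_pow_rootMultiplicity_mul_and_not_dvd P hP0 c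
  set k := P.rootMultiplicity c with hk
  have hQ0 : Q.eval c ≠ 0 := fun h0 => hQd (Polynomial.dvd_iff_isRoot.2 h0)
  have hQne : Q ≠ 0 := by rintro rfl; simp at hQ0
  have hmonic : ((Polynomial.X - Polynomial.C c) ^ k).Monic := (Polynomial.monic_X_sub_C c).pow k
  have hdegk : P.natDegree = k + Q.natDegree := by
    rw [hQ, hmonic.natDegree_mul' hQne, Polynomial.natDegree_pow, Polynomial.natDegree_X_sub_C,
      mul_one]
  have hkd : k < d + 1 := by
    by_contra hkd
    have hkd' : k = d + 1 := by omega
    have hQ1 : Q = Polynomial.C (Q.coeff 0) := Polynomial.eq_C_of_natDegree_eq_zero (by omega)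
    set q := Q.coeff 0 with hq
    rw [hQ1, hkd'] at hQ
    have hq0 : q ≠ 0 := by
      intro h0; rw [h0] at hQ1; simp [hQ1] at hQne
    have h1 : P.coeff d = 0 := by rw [hcoeff d (by omega), hbd]
    rw [hQ, Polynomial.coeff_mul_C, sub_eq_add_neg, ← Polynomial.C_neg,
      Polynomial.coeff_X_add_C_pow] at h1
    have hc : c = 0 := by
      have : ((d + 1).choose d : ℝ) ≠ 0 := by
        have := Nat.choose_pos (show d ≤ d + 1 by omega)
        positivity
      simpa [hq0, Nat.cast_add_one_ne_zero] using h1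
    obtain ⟨i, hi, hbi⟩ := hb
    refine hbi ?_
    rw [← hcoeff i hi, hQ, hc]
    simp [Polynomial.coeff_X_pow, hi.ne]
  refine ⟨k, hkd, ?_⟩
  have heval : ∀ t : ℝ, ∑ i ∈ Finset.range (d + 1), b i * (c + t) ^ i + (c + t) ^ (d + 1) * a =
      t ^ k * Q.eval (c + t) := by
    intro t
    have h1 : P.eval (c + t) = t ^ k * Q.eval (c + t) := by
      conv_lhs => rw [hQ]
      simp
    rw [← h1]
    simp [hPdef, Polynomial.eval_finsetSum]
    ring
  have hQa : AnalyticAt ℝ (fun t : ℝ => Q.eval (c + t)) 0 :=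
    AnalyticAt.comp (g := fun t : ℝ => Q.eval t) (f := fun t => c + t)
      (AnalyticOnNhd.eval_polynomial Q _ (Set.mem_univ _)) (by fun_prop)
  simp only [heval]
  refine (AnalyticAt.analyticOrderAt_eq_natCast (by fun_prop)).2
    ⟨_, hQa, by simpa using hQ0, by simp⟩

variable {ι : Type*} {U : Ultrafilter ι} {n : ℕ}

theorem Adm.consTail {x : ι → Fin (n + 1) → ℝ} {y : ι → Fin n → ℝ} {π : (Fin n → ℝ) → Fin n → ℝ}
    (hx : Tendsto x U (𝓝 0)) (h : Adm U (fun i => Fin.tail (x i)) y π) :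
    Adm U x (fun i => (Fin.cons (x i 0) (y i) : Fin (n + 1) → ℝ))
      (fun p => Fin.cons (p 0) (π (Fin.tail p))) := by
  have := h.cons (t := fun i => x i 0) (tendsto_pi_nhds.1 hx 0)
  simpa only [Fin.cons_self_tail] using this

theorem IsNormalCrossing.comp_tail {f : (Fin n → ℝ) → ℝ} (hf : IsNormalCrossing f) :
    IsNormalCrossing (fun p : Fin (n + 1) → ℝ => f (Fin.tail p)) := by
  obtain ⟨α, u, hu, hu0, h⟩ := hf
  refine ⟨Fin.cons 0 α, fun p => u (Fin.tail p), AnalyticAt.comp_tail hu, hu0, ?_⟩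
  filter_upwards [tendsto_tail.eventually h] with p hp
  rw [hp, mon_cons, pow_zero, one_mul]

theorem exists_adm_of_regular (hP : Monomializes U n) (d : ℕ) : ∀ x : ι → Fin (n + 1) → ℝ,
    Tendsto x U (𝓝 0) → ∀ f : (Fin (n + 1) → ℝ) → ℝ, AnalyticAt ℝ f 0 →
    analyticOrderAt (fun t : ℝ => f (Fin.cons t 0)) 0 = d →
    ∀ h : (Fin n → ℝ) → ℝ, AnalyticAt ℝ h 0 → ¬ h =ᶠ[𝓝 0] 0 →
    ∃ y π, Adm U x y π ∧ IsNormalCrossing (fun p => f (π p)) ∧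
      IsNormalCrossing (fun p => h (Fin.tail (π p))) := by
  induction d using Nat.strong_induction_on with
  | _ d ih =>
  intro x hx f hf hfd h hh hh0
  cases d with
  | zero =>
    have hf0 : f 0 ≠ 0 := by
      have h1 := (analyticAt_slice (f := f) (t := 0) (w := 0)
        (by rwa [cons_zero_zero])).analyticOrderAt_eq_zero.1 (by simpa using hfd)
      simpa [cons_zero_zero] using h1
    obtain ⟨y, π, hA, hNC⟩ := hP (fun i => Fin.tail (x i)) (tendsto_tail.comp hx) h hh hh0
    have hL := hA.consTail hx
    refine ⟨_, _, hL, isNormalCrossing_of_ne_zero (hL.analyticAt_comp hf) ?_, ?_⟩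
    · have := hL.map_zero
      rwa [this]
    · simpa only [Fin.tail_cons] using hNC.comp_tail
  | succ d =>
  obtain ⟨φ, hφ, hφ0, c, u, hc, hu, hu0, hc0, hcd, hfe⟩ := exists_tschirnhaus hf hfd
  have hxt : Tendsto (fun i => Fin.tail (x i)) U (𝓝 0) := tendsto_tail.comp hx
  have hS : Adm U x (fun i => Function.update (x i) 0 (x i 0 - φ (Fin.tail (x i))))
      (fun p => Function.update p 0 (φ (Fin.tail p) + p 0)) := by
    have := Adm.affine (U := U) (x := x) 0 (A := fun p => φ (Fin.tail p)) (B := fun _ => 1)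
      (AnalyticAt.comp_tail hφ) analyticAt_const (by simpa [tail_zero] using hφ0) (by simp)
      (by simp) (fun h0 => by simpa using h0.self_of_nhds) hx
      (q := fun i => x i 0 - φ (Fin.tail (x i))) (by
        have h1 : Tendsto (fun i => φ (Fin.tail (x i))) U (𝓝 (φ 0)) :=
          hφ.continuousAt.tendsto.comp hxt
        simpa [hφ0] using (tendsto_pi_nhds.1 hx 0).sub h1) (by simp)
    simpa only [one_mul] using this
  by_cases hall : ∀ i < d + 1, c i =ᶠ[𝓝 0] 0
  · obtain ⟨y, π, hA, hNC⟩ := hP _ (tendsto_tail.comp hS.tendsto) h hh hh0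
    have hL := hA.consTail hS.tendsto
    refine ⟨_, _, hS.trans hL, ?_, ?_⟩
    · refine (((isNormalCrossing_coord 0).pow (d + 1)).mul
        (isNormalCrossing_of_ne_zero (hL.analyticAt_comp hu) ?_)).congr ?_
      · have := hL.map_zero
        rwa [this]
      · have hall' : ∀ᶠ w in 𝓝 (0 : Fin n → ℝ), ∀ i ∈ Finset.range (d + 1), c i w = 0 :=
          (Finset.eventually_all _).2 fun i hi => hall i (Finset.mem_range.1 hi)
        filter_upwards [hL.tendsto_zero.eventually hfe,
          hL.tendsto_zero.eventually (tendsto_tail.eventually hall')] with p h1 h2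
        rw [h1, Finset.sum_eq_zero fun i hi => by rw [h2 i hi, zero_mul]]
        simp
    · simpa using hNC.comp_tail
  push Not at hall
  obtain ⟨y, π, γ, b, hA, hNC, hγ, hb, hb0, hbz, hcb⟩ :=
    exists_adm_newton hP (tendsto_tail.comp hS.tendsto) hh hh0 hc hc0 hall
  have hbd : b d 0 = 0 := hbz d (by omega) hcd
  have hL := hA.consTail hS.tendsto
  set Λ : (Fin (n + 1) → ℝ) → Fin (n + 1) → ℝ := fun p => Fin.cons (p 0) (π (Fin.tail p)) with hΛ
  have huΛ : AnalyticAt ℝ (fun p => u (Λ p)) 0 := hL.analyticAt_comp hu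
  have hbt : ∀ i, AnalyticAt ℝ (fun p : Fin (n + 1) → ℝ => b i (Fin.tail p)) 0 :=
    fun i => AnalyticAt.comp_tail (hb i)
  have hSL := hS.trans hL
  set τ : (Fin (n + 1) → ℝ) → Fin (n + 1) → ℝ :=
    fun p => Function.update (Λ p) 0 (φ (Fin.tail (Λ p)) + Λ p 0) with hτ
  have hτt : ∀ p, Fin.tail (τ p) = π (Fin.tail p) := fun p => by simp [hτ, hΛ]
  have hfτ : ∀ᶠ p in 𝓝 0, f (τ p) = ∑ i ∈ Finset.range (d + 1),
      mon γ (Fin.tail p) ^ (d + 1 - i) * b i (Fin.tail p) * p 0 ^ i +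
        p 0 ^ (d + 1) * u (Λ p) := by
    have hcb' : ∀ᶠ w in 𝓝 0, ∀ i ∈ Finset.range (d + 1),
        c i (π w) = mon γ w ^ (d + 1 - i) * b i w :=
      (Finset.eventually_all _).2 fun i hi => hcb i (Finset.mem_range.1 hi)
    filter_upwards [hL.tendsto_zero.eventually hfe, tendsto_tail.eventually hcb'] with p h1 h2
    rw [hτ, h1]
    simp only [hΛ, Fin.tail_cons, Fin.cons_zero]
    congr 1
    exact Finset.sum_congr rfl fun i hi => by rw [h2 i hi]
  rcases ratio_dichotomy (U := U)
    (fun i => (Fin.cons (Function.update (x i) 0 (x i 0 - φ (Fin.tail (x i))) 0) (y i) :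
      Fin (n + 1) → ℝ) 0) (fun i => mon γ (y i)) with ⟨q₀, q, hq, hxq⟩ | ⟨r, hr, hxr⟩
  · have hB := Adm.blowFirst hL.tendsto (γ := γ) (c := q₀) (by simp [mon_at_zero hγ]) hq
      (by simpa only [Fin.tail_cons] using hxq)
    set β : (Fin (n + 1) → ℝ) → Fin (n + 1) → ℝ :=
      fun p => Function.update p 0 (mon γ (Fin.tail p) * (q₀ + p 0)) with hβ
    have hβt : ∀ p, Fin.tail (β p) = Fin.tail p := fun p => by simp [hβ]
    set g : (Fin (n + 1) → ℝ) → ℝ := fun p => ∑ i ∈ Finset.range (d + 1),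
      b i (Fin.tail p) * (q₀ + p 0) ^ i + (q₀ + p 0) ^ (d + 1) * u (Λ (β p)) with hg
    have hga : AnalyticAt ℝ g 0 := by
      refine AnalyticAt.add (Finset.analyticAt_fun_sum _ fun i _ => (hbt i).mul (by fun_prop))
        (AnalyticAt.mul (by fun_prop) (hB.analyticAt_comp huΛ))
    have hfg : ∀ᶠ p in 𝓝 0, f (τ (β p)) = mon γ (Fin.tail p) ^ (d + 1) * g p := by
      filter_upwards [hB.tendsto_zero.eventually hfτ] with p hp
      rw [hp, hβt]
      have hβ0 : β p 0 = mon γ (Fin.tail p) * (q₀ + p 0) := by simp [hβ]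
      simp only [hg, hβ0]
      rw [mul_add (mon γ (Fin.tail p) ^ (d + 1)), Finset.mul_sum]
      congr 1
      · refine Finset.sum_congr rfl fun i hi => ?_
        have : d + 1 = (d + 1 - i) + i := by have := Finset.mem_range.1 hi; omega
        conv_rhs => rw [this, pow_add]
        rw [mul_pow]
        ring
      · rw [mul_pow]
        ring
    obtain ⟨k, hk, hkord⟩ := exists_order_lt (d := d) (b := fun i => b i 0) (c := q₀) hu0 hb0 hbd
    have hslice : (fun t : ℝ => g (Fin.cons t 0)) = fun t : ℝ =>
        ∑ i ∈ Finset.range (d + 1), b i 0 * (q₀ + t) ^ i + (q₀ + t) ^ (d + 1) * u 0 := by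
      funext t
      have h1 : Λ (β (Fin.cons t 0)) = 0 := by
        have : β (Fin.cons t 0) = 0 := by
          simp only [hβ, Fin.tail_cons, mon_at_zero hγ, zero_mul, Fin.update_cons_zero,
            cons_zero_zero]
        rw [this]
        exact hL.map_zero
      simp only [hg, h1, Fin.tail_cons, Fin.cons_zero]
    have hh1 : ¬ (fun w => mon γ w * h (π w)) =ᶠ[𝓝 0] 0 := fun h0 => by
      rcases eventuallyEq_zero_or_of_mul (analyticAt_mon γ 0) (hA.analyticAt_comp hh) h0 with h1 | h1
      · exact (isNormalCrossing_mon γ).not_eventually_zero h1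
      · exact hA.not_eventually_zero hh hh0 h1
    obtain ⟨z, ψ, hC, hNCg, hNCh⟩ := ih k hk _ hB.tendsto g hga (by rw [hslice, hkord])
      (fun w => mon γ w * h (π w)) ((analyticAt_mon γ 0).mul (hA.analyticAt_comp hh)) hh1
    have hm1 := hC.analyticAt_comp (analyticAt_mon_tail γ 0)
    have hm2 := hC.analyticAt_comp (AnalyticAt.comp_tail (hA.analyticAt_comp hh))
    refine ⟨z, _, (hSL.trans hB).trans hC, ?_, ?_⟩
    · exact (((IsNormalCrossing.left_of_mul hm1 hm2 hNCh).pow (d + 1)).mul hNCg).congr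
        (hC.tendsto_zero.eventually hfg)
    · refine (IsNormalCrossing.right_of_mul hm1 hm2 hNCh).congr (Eventually.of_forall fun p => ?_)
      simp only [hτt, hβt]
  · obtain ⟨z, ψ, s, hC, hNCψ, hs, hs0, hsψ⟩ := exists_adm_dvd (γ := γ) hL.tendsto hr
      (by simpa only [Fin.tail_cons] using hxr)
    refine ⟨z, _, hSL.trans hC, ?_, ?_⟩
    · set g : (Fin (n + 1) → ℝ) → ℝ := fun p => ∑ i ∈ Finset.range (d + 1),
        s p ^ (d + 1 - i) * b i (Fin.tail (ψ p)) + u (Λ (ψ p)) with hg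
      have hga : AnalyticAt ℝ g 0 := by
        refine AnalyticAt.add (Finset.analyticAt_fun_sum _ fun i _ =>
          (hs.pow _).mul (hC.analyticAt_comp (hbt i))) (hC.analyticAt_comp huΛ)
      have hg0 : g 0 ≠ 0 := by
        have h1 : Λ (ψ 0) = 0 := by rw [hC.map_zero]; exact hL.map_zero
        have h2 : g 0 = u 0 := by
          simp only [hg, h1, hs0]
          rw [Finset.sum_eq_zero, zero_add]
          intro i hi
          have : d + 1 - i ≠ 0 := by have := Finset.mem_range.1 hi; omega
          rw [zero_pow this, zero_mul]
        rwa [h2]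
      refine (((hNCψ 0).pow (d + 1)).mul (isNormalCrossing_of_ne_zero hga hg0)).congr ?_
      filter_upwards [hC.tendsto_zero.eventually hfτ, hsψ] with p h1 h2
      rw [h1, h2]
      simp only [hg, mul_add, Finset.mul_sum]
      congr 1
      refine Finset.sum_congr rfl fun i hi => ?_
      have : d + 1 = (d + 1 - i) + i := by have := Finset.mem_range.1 hi; omega
      conv_rhs => rw [this, pow_add]
      rw [mul_pow]
      simp only [Nat.add_sub_cancel]
      ring
    · simp only [hτt]
      exact hNC.comp_tail.comp hC.analyticAt hC.map_zero hNCψ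

theorem exists_regular_direction {f : (Fin (n + 1) → ℝ) → ℝ} (hf : AnalyticAt ℝ f 0)
    (hf0 : ¬ f =ᶠ[𝓝 0] 0) : ∃ v : Fin (n + 1) → ℝ, v ≠ 0 ∧
      analyticOrderAt (fun t : ℝ => f (t • v)) 0 ≠ ⊤ := by
  by_cases h0 : f 0 = 0
  swap
  · refine ⟨Pi.single 0 1, by simp, fun htop => h0 ?_⟩
    simpa using (analyticOrderAt_eq_top.1 htop).self_of_nhds
  obtain ⟨ε, hε, hball⟩ := Metric.eventually_nhds_iff_ball.1 hf.eventually_analyticAt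
  have hfr : ∃ᶠ p in 𝓝 (0 : Fin (n + 1) → ℝ), f p ≠ 0 := fun h => hf0 (by
    filter_upwards [h] with p hp
    simpa using hp)
  obtain ⟨v, hv, hvb⟩ := (hfr.and_eventually (Metric.ball_mem_nhds 0 hε)).exists
  refine ⟨v, fun h => hv (by rw [h, h0]), fun htop => hv ?_⟩
  have hon : AnalyticOnNhd ℝ (fun t : ℝ => f (t • v)) (Set.Icc 0 1) := by
    intro t ht
    refine AnalyticAt.comp (g := f) (f := fun t : ℝ => t • v) (hball _ ?_) (by fun_prop)
    rw [mem_ball_zero_iff, norm_smul, Real.norm_eq_abs, abs_of_nonneg ht.1]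
    rw [dist_zero_right] at hvb
    exact (mul_le_of_le_one_left (norm_nonneg _) ht.2).trans_lt hvb
  have := hon.eqOn_zero_of_preconnected_of_eventuallyEq_zero isPreconnected_Icc
    (Set.left_mem_Icc.2 zero_le_one) (analyticOrderAt_eq_top.1 htop)
    (Set.right_mem_Icc.2 zero_le_one)
  simpa using this

theorem monomializes (U : Ultrafilter ι) (n : ℕ) : Monomializes U n := by
  induction n with
  | zero =>
    intro x hx f hf hf0
    refine ⟨x, _, Adm.refl hx, isNormalCrossing_of_ne_zero hf fun h0 => hf0 ?_⟩
    filter_upwards with p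
    rw [Subsingleton.elim p 0]
    exact h0
  | succ n ih =>
    intro x hx f hf hf0
    obtain ⟨v, hv, hord⟩ := exists_regular_direction hf hf0
    obtain ⟨e, he⟩ := SeparatingDual.exists_continuousLinearEquiv_apply_eq (R := ℝ)
      (x := (Pi.single 0 1 : Fin (n + 1) → ℝ)) (y := v) (by simp) hv
    have hE := Adm.of_equiv e hx
    obtain ⟨k, hk⟩ := ENat.ne_top_iff_exists.1 hord
    have hslice : (fun t : ℝ => f (e (Fin.cons t 0))) = fun t : ℝ => f (t • v) := by
      funext t
      have : (Fin.cons t 0 : Fin (n + 1) → ℝ) = t • Pi.single 0 1 := by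
        ext j
        refine Fin.cases ?_ (fun j => ?_) j <;> simp
      rw [this, map_smul, he]
    obtain ⟨y, π, hA, hNC, -⟩ := exists_adm_of_regular ih k _ hE.tendsto (fun p => f (e p))
      (hE.analyticAt_comp hf) (by rw [hslice, hk]) (fun _ => 1) analyticAt_const
      (fun h0 => by simpa using h0.self_of_nhds)
    exact ⟨y, _, hE.trans hA, hNC⟩

section Lojasiewicz

variable {n : ℕ}

theorem mon_add_smul_single (α : Fin n → ℕ) (y : Fin n → ℝ) (i : Fin n) (t : ℝ) :
    mon α (y + t • Pi.single i (y i)) = mon α y * (1 + t) ^ α i := by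
  have h : ∀ j, (y + t • (Pi.single i (y i) : Fin n → ℝ)) j ^ α j =
      y j ^ α j * (if j = i then (1 + t) ^ α i else 1) := by
    intro j
    by_cases hj : j = i
    · subst hj
      simp only [Pi.add_apply, Pi.smul_apply, Pi.single_eq_same, smul_eq_mul, if_true]
      rw [← mul_pow]
      congr 1
      ring
    · simp [hj]
  simp only [mon, h, Finset.prod_mul_distrib, Finset.prod_ite_eq', Finset.mem_univ, if_true]

theorem fderiv_mon_single (α : Fin n → ℕ) (y : Fin n → ℝ) (i : Fin n) :
    fderiv ℝ (mon α) y (Pi.single i (y i)) = α i * mon α y := by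
  have h1 := (analyticAt_mon α y).differentiableAt.hasFDerivAt.hasLineDerivAt (Pi.single i (y i))
  have h2 : HasLineDerivAt ℝ (mon α) (α i * mon α y) y (Pi.single i (y i)) := by
    unfold HasLineDerivAt
    simp only [mon_add_smul_single]
    have := (((hasDerivAt_id (0 : ℝ)).const_add 1).pow (α i)).const_mul (mon α y)
    simpa [mul_comm] using this
  exact h1.unique h2

theorem pow_le_pow_succ_of_le {a b : ℝ} (ha : 0 ≤ a) (ha1 : a ≤ 1) (hb : 0 ≤ b) {N m : ℕ}
    (hN : N ≠ 0) (hNm : N ≤ m) (h : a ^ N ≤ b ^ (N + 1)) : a ^ m ≤ b ^ (m + 1) := by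
  rcases le_total 1 b with hb1 | hb1
  · exact (pow_le_one₀ ha ha1).trans (one_le_pow₀ hb1)
  · refine le_of_pow_le_pow_left₀ hN (by positivity) ?_
    calc (a ^ m) ^ N = (a ^ N) ^ m := by rw [← pow_mul, ← pow_mul, mul_comm]
      _ ≤ (b ^ (N + 1)) ^ m := by gcongr
      _ = b ^ ((N + 1) * m) := by rw [← pow_mul]
      _ ≤ b ^ ((m + 1) * N) := pow_le_pow_of_le_one hb hb1 (by nlinarith)
      _ = (b ^ (m + 1)) ^ N := by rw [← pow_mul]

/-- The gradient inequality along a substitution making the function normal crossing. -/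
theorem exists_gradient_inequality_comp {f : (Fin n → ℝ) → ℝ} {π : (Fin n → ℝ) → Fin n → ℝ}
    (hf : AnalyticAt ℝ f 0) (hf0 : f 0 = 0) (hπ : AnalyticAt ℝ π 0) (hπ0 : π 0 = 0)
    (h : IsNormalCrossing fun p => f (π p)) :
    ∃ N : ℕ, N ≠ 0 ∧ ∃ C : ℝ, ∀ᶠ y in 𝓝 0, |f (π y)| ^ N ≤ (C * ‖fderiv ℝ f (π y)‖) ^ (N + 1) := by
  obtain ⟨α, u, hu, hu0, hfu⟩ := h
  have hα : α ≠ 0 := by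
    rintro rfl
    have := hfu.self_of_nhds
    simp [hπ0, hf0, mon, hu0.symm] at this
  obtain ⟨i₀, hi₀⟩ : ∃ i, α i ≠ 0 := by
    by_contra! hc
    exact hα (funext hc)
  set c := |u 0| / 4 with hc
  have hcpos : 0 < c := by positivity
  set D := ‖fderiv ℝ π 0‖ + 1 with hD
  have hDpos : 0 < D := by positivity
  have hsum : (∑ i, α i) ≠ 0 := fun h0 => hi₀ (by simpa using (Finset.sum_eq_zero_iff.1 h0) i₀)
  refine ⟨∑ i, α i, hsum, (8 * c + 1) * D / c, ?_⟩
  have hπt : Tendsto π (𝓝 0) (𝓝 0) := by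
    simpa [hπ0] using hπ.continuousAt.tendsto
  have e1 : ∀ᶠ y in 𝓝 (0 : Fin n → ℝ), ‖fderiv ℝ π y‖ < D :=
    (hπ.fderiv.continuousAt.norm.tendsto).eventually_lt_const (by simp [hD])
  have e2 : ∀ᶠ y in 𝓝 (0 : Fin n → ℝ), |u y| < 8 * c :=
    hu.continuousAt.abs.tendsto.eventually_lt_const (by simp only [hc]; linarith [abs_pos.2 hu0])
  have e3 : ∀ᶠ y in 𝓝 (0 : Fin n → ℝ), c < |u y| - ‖fderiv ℝ u y‖ * ‖y‖ := by
    have : ContinuousAt (fun y => |u y| - ‖fderiv ℝ u y‖ * ‖y‖) 0 :=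
      hu.continuousAt.abs.sub (hu.fderiv.continuousAt.norm.mul continuous_norm.continuousAt)
    exact this.tendsto.eventually_const_lt (by simp only [hc, norm_zero]; linarith [abs_pos.2 hu0])
  have e4 : ∀ᶠ y in 𝓝 (0 : Fin n → ℝ), ‖y‖ < 1 :=
    continuous_norm.continuousAt.tendsto.eventually_lt_const (by simp)
  filter_upwards [hfu.eventually_nhds, e1, e2, e3, e4, hπ.eventually_analyticAt,
    hπt.eventually hf.eventually_analyticAt, hu.eventually_analyticAt] with
    y hy h1 h2 h3 h4 hπy hfy huy
  obtain ⟨i, hi, hmin⟩ := Finset.exists_min_image (Finset.univ.filter fun i => α i ≠ 0)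
    (fun i => |y i|) ⟨i₀, by simpa using hi₀⟩
  replace hi : α i ≠ 0 := by simpa using hi
  set r := |y i| with hr
  set m := |mon α y| with hm
  set g := ‖fderiv ℝ f (π y)‖ with hg
  have hr0 : 0 ≤ r := abs_nonneg _
  have hm0 : 0 ≤ m := abs_nonneg _
  have hg0 : 0 ≤ g := norm_nonneg _
  have hry : r ≤ ‖y‖ := norm_le_pi_norm y i
  have hr1 : r ≤ 1 := hry.trans h4.le
  have hrm : r ^ (∑ i, α i) ≤ m := by
    rw [← Finset.prod_pow_eq_pow_sum, hm, mon, Finset.abs_prod]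
    refine Finset.prod_le_prod (fun j _ => pow_nonneg hr0 _) fun j _ => ?_
    rw [abs_pow]
    by_cases hj : α j = 0
    · simp [hj]
    · exact pow_le_pow_left₀ hr0 (hmin j (by simpa using hj)) _
  have hder : fderiv ℝ (fun p => f (π p)) y (Pi.single i (y i)) =
      mon α y * (α i * u y + fderiv ℝ u y (Pi.single i (y i))) := by
    rw [Filter.EventuallyEq.fderiv_eq hy,
      fderiv_fun_mul (analyticAt_mon α y).differentiableAt huy.differentiableAt]
    simp only [add_apply, smul_apply, fderiv_mon_single,
      smul_eq_mul]
    ring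
  have hsingle : ‖(Pi.single i (y i) : Fin n → ℝ)‖ = r := by
    rw [Pi.norm_single, Real.norm_eq_abs]
  have hup : ‖fderiv ℝ (fun p => f (π p)) y (Pi.single i (y i))‖ ≤ g * (D * r) := by
    have : fderiv ℝ (fun p => f (π p)) y = (fderiv ℝ f (π y)).comp (fderiv ℝ π y) :=
      fderiv_comp y hfy.differentiableAt hπy.differentiableAt
    rw [this, ContinuousLinearMap.comp_apply]
    refine (ContinuousLinearMap.le_opNorm _ _).trans ?_
    gcongr
    refine (ContinuousLinearMap.le_opNorm _ _).trans ?_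
    rw [hsingle]
    gcongr
  have hlow : m * c ≤ g * (D * r) := by
    refine le_trans ?_ hup
    rw [hder, Real.norm_eq_abs, abs_mul]
    refine mul_le_mul_of_nonneg_left (h3.le.trans ?_) hm0
    have h5 : |fderiv ℝ u y (Pi.single i (y i))| ≤ ‖fderiv ℝ u y‖ * ‖y‖ := by
      rw [← Real.norm_eq_abs]
      refine (ContinuousLinearMap.le_opNorm _ _).trans ?_
      rw [hsingle]
      gcongr
    have h6 : |u y| ≤ |α i * u y| := by
      rw [abs_mul, Nat.abs_cast]
      exact le_mul_of_one_le_left (abs_nonneg _) (by exact_mod_cast Nat.one_le_iff_ne_zero.2 hi)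
    have h7 := abs_sub_abs_le_abs_sub (α i * u y) (-fderiv ℝ u y (Pi.single i (y i)))
    rw [abs_neg, sub_neg_eq_add] at h7
    linarith
  set N := ∑ i, α i
  have hF : |f (π y)| = m * |u y| := by rw [hy.self_of_nhds, abs_mul]
  rcases hm0.eq_or_lt with hm00 | hmpos
  · rw [hF, ← hm00, zero_mul, zero_pow hsum]
    positivity
  have key : m ^ N ≤ (D * g / c) ^ (N + 1) := by
    rw [div_pow, le_div_iff₀ (by positivity)]
    refine le_of_mul_le_mul_left ?_ hmpos
    calc m * (m ^ N * c ^ (N + 1)) = (m * c) ^ (N + 1) := by ring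
      _ ≤ (g * (D * r)) ^ (N + 1) := by gcongr
      _ = (D * g) ^ (N + 1) * (r ^ N * r) := by
        rw [← mul_assoc, mul_pow, pow_succ r, mul_comm g D]
      _ ≤ (D * g) ^ (N + 1) * (m * 1) := by gcongr
      _ = m * (D * g) ^ (N + 1) := by ring
  calc |f (π y)| ^ N = |u y| ^ N * m ^ N := by rw [hF, mul_pow, mul_comm]
    _ ≤ (8 * c + 1) ^ N * (D * g / c) ^ (N + 1) := by
        gcongr
        linarith
    _ ≤ (8 * c + 1) ^ (N + 1) * (D * g / c) ^ (N + 1) := by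
        gcongr
        · linarith
        · omega
    _ = ((8 * c + 1) * D / c * g) ^ (N + 1) := by
        rw [← mul_pow, ← mul_div_assoc, ← mul_assoc, mul_div_right_comm]

/-- Łojasiewicz's gradient inequality at a zero at the origin. -/
theorem lojasiewicz_zero {f : (Fin n → ℝ) → ℝ} (hf : AnalyticAt ℝ f 0) (hf0 : f 0 = 0) :
    ∃ N : ℕ, ∃ C : ℝ, 0 < C ∧ ∀ᶠ x in 𝓝 0, |f x| ^ N ≤ (C * ‖fderiv ℝ f x‖) ^ (N + 1) := by
  by_cases hz : f =ᶠ[𝓝 0] 0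
  · refine ⟨1, 1, one_pos, ?_⟩
    filter_upwards [hz] with x hx
    rw [hx]
    simp only [Pi.zero_apply, abs_zero, pow_one]
    positivity
  by_contra! hcon
  have hex : ∀ k : ℕ, ∃ x : Fin n → ℝ, (((k : ℝ) + 1) * ‖fderiv ℝ f x‖) ^ (k + 1 + 1) <
      |f x| ^ (k + 1) ∧ |f x| < 1 ∧ ‖x‖ < 1 / ((k : ℝ) + 1) := by
    intro k
    have h1 : ∀ᶠ x in 𝓝 (0 : Fin n → ℝ), |f x| < 1 :=
      hf.continuousAt.abs.tendsto.eventually_lt_const (by simp [hf0])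
    have h2 : ∀ᶠ x in 𝓝 (0 : Fin n → ℝ), ‖x‖ < 1 / ((k : ℝ) + 1) :=
      continuous_norm.continuousAt.tendsto.eventually_lt_const (by simp; positivity)
    have h3 := hcon (k + 1) ((k : ℝ) + 1) (by positivity)
    exact ((h3).and_eventually (h1.and h2)).exists
  choose x hx1 hx2 hx3 using hex
  have hxt : Tendsto x atTop (𝓝 0) := squeeze_zero_norm (fun k => (hx3 k).le)
    tendsto_one_div_add_atTop_nhds_zero_nat
  let U : Ultrafilter ℕ := Ultrafilter.of atTop
  have hU : (U : Filter ℕ) ≤ atTop := Ultrafilter.of_le _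
  obtain ⟨y, π, hA, hNC⟩ := monomializes U n x (hxt.mono_left hU) f hf hz
  obtain ⟨N, hN, C, hC⟩ := exists_gradient_inequality_comp hf hf0 hA.analyticAt hA.map_zero hNC
  have hev : ∀ᶠ k in (U : Filter ℕ), False := by
    filter_upwards [hA.tendsto.eventually hC, hA.lift, hU (eventually_ge_atTop N),
      hU ((tendsto_natCast_atTop_atTop (R := ℝ)).eventually_ge_atTop |C|)] with k h1 h2 h3 h4
    rw [h2] at h1
    have h5 : |f (x k)| ^ N ≤ (((k : ℝ) + 1) * ‖fderiv ℝ f (x k)‖) ^ (N + 1) := by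
      refine h1.trans ((le_abs_self _).trans ?_)
      rw [abs_pow, abs_mul, abs_norm]
      gcongr
      linarith
    exact absurd (pow_le_pow_succ_of_le (abs_nonneg _) (hx2 k).le (by positivity) hN
      (show N ≤ k + 1 by have : N ≤ k := h3; omega) h5) (not_le.2 (hx1 k))
  exact (Filter.eventually_false_iff_eq_bot.1 hev ▸ U.neBot).ne rfl

/-- Łojasiewicz's gradient inequality for analytic functions on Euclidean space. -/
theorem lojasiewicz {f : EuclideanSpace ℝ (Fin n) → ℝ} {a : EuclideanSpace ℝ (Fin n)}
    (hf : AnalyticAt ℝ f a) :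
    ∃ N : ℕ, ∃ C : ℝ, 0 < C ∧
      ∀ᶠ x in 𝓝 a, |f x - f a| ^ N ≤ (C * ‖fderiv ℝ f x‖) ^ (N + 1) := by
  let e := (EuclideanSpace.equiv (Fin n) ℝ).symm
  let h : (Fin n → ℝ) → ℝ := fun p => f (a + e p) - f a
  have hh : AnalyticAt ℝ h 0 := by
    refine AnalyticAt.sub ?_ analyticAt_const
    refine AnalyticAt.comp (g := f) (f := fun p => a + e p) (by simpa using hf) ?_
    exact analyticAt_const.add (e.toContinuousLinearMap.analyticAt 0)
  obtain ⟨N, C, hC, hev⟩ := lojasiewicz_zero hh (by simp [h])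
  refine ⟨N, C * (‖(e : (Fin n → ℝ) →L[ℝ] EuclideanSpace ℝ (Fin n))‖ + 1), by positivity, ?_⟩
  have ht : Tendsto (fun x => e.symm (x - a)) (𝓝 a) (𝓝 0) := by
    have : ContinuousAt (fun x => e.symm (x - a)) a := by fun_prop
    simpa using this.tendsto
  filter_upwards [ht.eventually hev, hf.eventually_analyticAt] with x hx hfx
  have hxa : a + e (e.symm (x - a)) = x := by simp
  have hd : fderiv ℝ h (e.symm (x - a)) =
      (fderiv ℝ f x).comp (e : (Fin n → ℝ) →L[ℝ] EuclideanSpace ℝ (Fin n)) := by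
    have h1 : HasFDerivAt (fun p => a + e p) (e : (Fin n → ℝ) →L[ℝ] EuclideanSpace ℝ (Fin n))
        (e.symm (x - a)) := (e.hasFDerivAt).const_add a
    have h2 : HasFDerivAt f (fderiv ℝ f x) (a + e (e.symm (x - a))) := by
      rw [hxa]; exact hfx.differentiableAt.hasFDerivAt
    exact ((HasFDerivAt.comp (g := f) (f := fun p => a + e p) _ h2 h1).sub_const (f a)).fderiv
  rw [hd] at hx
  simp only [h, hxa] at hx
  refine hx.trans ?_
  rw [mul_assoc]
  gcongr
  refine (ContinuousLinearMap.opNorm_comp_le _ _).trans ?_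
  rw [mul_comm]
  gcongr
  linarith

end Lojasiewicz

section Descent

variable {E : Type*} [NormedAddCommGroup E] [InnerProductSpace ℝ E] [FiniteDimensional ℝ E]

/-- If the gradient inequality holds at a point, a step of sufficient decrease is bounded by the
decrease of the desingularized value. -/
theorem step_le_of_gradient_inequality {N : ℕ} {C μ g s s' p p' : ℝ} (hC : 0 < C) (hμ : 0 < μ)
    (hg : 0 ≤ g) (hp : 0 ≤ p) (hp' : 0 ≤ p') (hps : p ^ (N + 1) = s) (hps' : p' ^ (N + 1) = s')
    (hloj : s ^ N ≤ (C * g) ^ (N + 1)) (hdesc : s' ≤ s - μ / 2 * g ^ 2) :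
    μ * g ≤ 2 * (N + 1) * C * (p - p') := by
  have hpp : p' ≤ p := by
    refine le_of_pow_le_pow_left₀ (Nat.succ_ne_zero N) hp ?_
    rw [hps, hps']
    nlinarith [sq_nonneg g]
  have hpN : p ^ N ≤ C * g := by
    refine le_of_pow_le_pow_left₀ (Nat.succ_ne_zero N) (by positivity) ?_
    calc (p ^ N) ^ (N + 1) = s ^ N := by rw [← hps, ← pow_mul, ← pow_mul, mul_comm]
      _ ≤ _ := hloj
  have hconc : s - s' ≤ (N + 1) * p ^ N * (p - p') := by
    have h1 : p ^ (N + 1) - p' ^ (N + 1) =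
        (∑ i ∈ Finset.range (N + 1), p ^ i * p' ^ (N - i)) * (p - p') :=
      ((Commute.all p p').geom_sum₂_mul (N + 1)).symm
    rw [← hps, ← hps', h1]
    refine mul_le_mul_of_nonneg_right ?_ (sub_nonneg.2 hpp)
    calc ∑ i ∈ Finset.range (N + 1), p ^ i * p' ^ (N - i)
        ≤ ∑ i ∈ Finset.range (N + 1), p ^ N := by
          refine Finset.sum_le_sum fun i hi => ?_
          have : N = i + (N - i) := by have := Finset.mem_range.1 hi; omega
          calc p ^ i * p' ^ (N - i) ≤ p ^ i * p ^ (N - i) := by gcongr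
            _ = p ^ N := by rw [← pow_add, ← this]
      _ = _ := by simp
  rcases hg.eq_or_lt with rfl | hgpos
  · rw [mul_zero]
    have := sub_nonneg.2 hpp
    positivity
  refine le_of_mul_le_mul_right ?_ hgpos
  have h2 : (N + 1) * p ^ N * (p - p') ≤ (N + 1) * (C * g) * (p - p') := by
    have := sub_nonneg.2 hpp
    gcongr
  nlinarith

/-- Bounded descent sequences with sufficient decrease converge to a critical point when the
gradient inequality holds everywhere. -/
theorem exists_limit_of_descent {f : E → ℝ} {G : E → E} (hf : Continuous f) (hG : Continuous G)
    (hloj : ∀ a, ∃ N : ℕ, ∃ C : ℝ, 0 < C ∧ ∀ᶠ x in 𝓝 a, |f x - f a| ^ N ≤ (C * ‖G x‖) ^ (N + 1))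
    {μ R : ℝ} (hμ : 0 < μ) {x : ℕ → E} (hx : ∀ t, x (t + 1) = x t - μ • G (x t))
    (hR : ∀ t, ‖x t‖ ≤ R) (hdesc : ∀ t, f (x (t + 1)) ≤ f (x t) - μ / 2 * ‖G (x t)‖ ^ 2) :
    ∃ a, Tendsto x atTop (𝓝 a) ∧ G a = 0 := by
  obtain ⟨a, -, φ, hφ, hφa⟩ := tendsto_subseq_of_bounded (Metric.isBounded_closedBall (x := (0 : E))
    (r := R)) (fun t => by simpa using hR t)
  have hanti : Antitone fun t => f (x t) := antitone_nat_of_succ_le fun t =>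
    (hdesc t).trans (by nlinarith [sq_nonneg ‖G (x t)‖])
  have hsub : Tendsto (fun k => f (x (φ k))) atTop (𝓝 (f a)) := (hf.tendsto a).comp hφa
  have hlim : Tendsto (fun t => f (x t)) atTop (𝓝 (f a)) := by
    rcases tendsto_atTop_of_antitone hanti with h | ⟨l, hl⟩
    · exact absurd hsub (not_tendsto_nhds_of_tendsto_atBot (h.comp hφ.tendsto_atTop) _)
    · rwa [tendsto_nhds_unique hsub (hl.comp hφ.tendsto_atTop)]
  have hge : ∀ t, f a ≤ f (x t) := fun t => hanti.le_of_tendsto hlim t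
  obtain ⟨N, C, hC, hev⟩ := hloj a
  obtain ⟨δ, hδ, hball⟩ := Metric.eventually_nhds_iff.1 hev
  set p : ℕ → ℝ := fun t => (f (x t) - f a) ^ ((N + 1 : ℕ) : ℝ)⁻¹ with hp
  have hp0 : ∀ t, 0 ≤ p t := fun t => Real.rpow_nonneg (sub_nonneg.2 (hge t)) _
  have hpp : ∀ t, p t ^ (N + 1) = f (x t) - f a := fun t =>
    Real.rpow_inv_natCast_pow (sub_nonneg.2 (hge t)) (Nat.succ_ne_zero N)
  have hplim : Tendsto p atTop (𝓝 0) := by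
    have h1 : Tendsto (fun t => f (x t) - f a) atTop (𝓝 0) := by simpa using hlim.sub_const (f a)
    have h2 := h1.rpow_const (p := ((N + 1 : ℕ) : ℝ)⁻¹) (Or.inr (by positivity))
    rwa [Real.zero_rpow (by positivity)] at h2
  set K := 2 * (N + 1) * C with hK
  have hKpos : 0 < K := by positivity
  have hstep : ∀ t, dist (x t) a < δ → dist (x (t + 1)) a + K * p (t + 1) ≤
      dist (x t) a + K * p t := by
    intro t ht
    have h1 := hball ht
    rw [abs_of_nonneg (sub_nonneg.2 (hge t))] at h1
    have h2 := step_le_of_gradient_inequality hC hμ (norm_nonneg _) (hp0 t) (hp0 (t + 1)) (hpp t)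
      (hpp (t + 1)) h1 (by linarith [hdesc t])
    have h3 : dist (x (t + 1)) (x t) = μ * ‖G (x t)‖ := by
      rw [hx t, dist_eq_norm, sub_sub_cancel_left, norm_neg, norm_smul, Real.norm_eq_abs,
        abs_of_pos hμ]
    have h4 := dist_triangle (x (t + 1)) (x t) a
    rw [← hK] at h2
    linarith
  have hxa : Tendsto x atTop (𝓝 a) := by
    rw [Metric.tendsto_atTop]
    intro ε hε
    have h1 : Tendsto (fun k => dist (x (φ k)) a + K * p (φ k)) atTop (𝓝 0) := by
      have := (tendsto_iff_dist_tendsto_zero.1 hφa).add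
        ((hplim.comp hφ.tendsto_atTop).const_mul K)
      simpa using this
    obtain ⟨k, hk⟩ := (h1.eventually_lt_const (lt_min hε hδ)).exists
    have h2 : ∀ j, dist (x (φ k + j)) a + K * p (φ k + j) < min ε δ := by
      intro j
      induction j with
      | zero => exact hk
      | succ j ih =>
        refine (hstep (φ k + j) ?_).trans_lt ih
        have := mul_nonneg hKpos.le (hp0 (φ k + j))
        linarith [min_le_right ε δ]
    refine ⟨φ k, fun t ht => ?_⟩
    obtain ⟨j, rfl⟩ := Nat.exists_eq_add_of_le ht
    have := mul_nonneg hKpos.le (hp0 (φ k + j))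
    linarith [h2 j, min_le_left ε δ]
  refine ⟨a, hxa, ?_⟩
  have h1 : Tendsto (fun t => x t - μ • G (x t)) atTop (𝓝 (a - μ • G a)) :=
    hxa.sub (((hG.tendsto a).comp hxa).const_smul μ)
  have h2 : Tendsto (fun t => x t - μ • G (x t)) atTop (𝓝 a) := by
    simp only [← hx]
    exact (tendsto_add_atTop_iff_nat 1).2 hxa
  have h3 := tendsto_nhds_unique h1 h2
  rw [sub_eq_self] at h3
  exact (smul_eq_zero.1 h3).resolve_left hμ.ne'

/-- A gradient step with small step size decreases the function, when the gradient is Lipschitz on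
a convex set containing both ends. -/
theorem descent_step {f : E → ℝ} {G : E → E} (hf : ∀ x, HasGradientAt f (G x) x) {s : Set E}
    (hs : Convex ℝ s) {M μ : ℝ} (hM : ∀ x ∈ s, ∀ y ∈ s, ‖G x - G y‖ ≤ M * ‖x - y‖) (hM0 : 0 ≤ M)
    (hμ : 0 < μ) (hμM : μ * M ≤ 1 / 2) {x : E} (hx : x ∈ s) (hy : x - μ • G x ∈ s) :
    f (x - μ • G x) ≤ f x - μ / 2 * ‖G x‖ ^ 2 := by
  set y := x - μ • G x with hydef
  have hseg : segment ℝ x y ⊆ s := hs.segment_subset hx hy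
  have hyx : y - x = -(μ • G x) := by simp [hydef]
  have hyxn : ‖y - x‖ = μ * ‖G x‖ := by
    rw [hyx, norm_neg, norm_smul, Real.norm_eq_abs, abs_of_pos hμ]
  have h1 := (convex_segment x y).norm_image_sub_le_of_norm_hasFDerivWithin_le'
    (f := f) (f' := fun z => InnerProductSpace.toDual ℝ E (G z))
    (φ := InnerProductSpace.toDual ℝ E (G x)) (C := M * ‖y - x‖) (x := x) (y := y)
    (fun z _ => (hf z).hasFDerivAt.hasFDerivWithinAt)
    (fun z hz => by
      rw [← map_sub, LinearIsometryEquiv.norm_map]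
      refine (hM z (hseg hz) x hx).trans (mul_le_mul_of_nonneg_left ?_ hM0)
      exact norm_sub_le_of_mem_segment hz)
    (left_mem_segment ℝ x y) (right_mem_segment ℝ x y)
  rw [InnerProductSpace.toDual_apply_apply, hyxn, hyx, inner_neg_right, inner_smul_right,
    real_inner_self_eq_norm_sq] at h1
  have h2 := le_of_abs_le h1
  nlinarith [mul_nonneg hμ.le (sq_nonneg ‖G x‖)]

end Descent

section Saddle

variable {E : Type*} [NormedAddCommGroup E] [InnerProductSpace ℝ E]

/-- The expansion of a shifted quadratic form under one linearized gradient step. -/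
theorem quadratic_expansion {H T : E →L[ℝ] E} (hsymm : ∀ x y, inner ℝ (H x) y = inner ℝ x (H y))
    {κ μ c : ℝ} (hT : ∀ h, T h = H h + κ • h) (hκ : 0 < κ) (hμ : 0 < μ) (hμH : μ * ‖H‖ ≤ 1 / 2)
    (hc : 0 < c) (hcT : ∀ h, c * ‖h‖ ≤ ‖T h‖) (h : E) :
    (1 + μ * κ) ^ 2 * inner ℝ h (T h) - μ * c ^ 2 * ‖h‖ ^ 2 ≥
      inner ℝ (h - μ • H h) (T (h - μ • H h)) := by
  have hTsymm : ∀ x y, inner ℝ (T x) y = inner ℝ x (T y) := fun x y => by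
    simp only [hT, inner_add_left, inner_add_right, inner_smul_left, inner_smul_right, hsymm]
    simp
  have h1 : h - μ • H h = (1 + μ * κ) • h - μ • T h := by
    rw [hT]; module
  have h2 : inner ℝ (T h) (T (T h)) ≤ (‖H‖ + κ) * ‖T h‖ ^ 2 := by
    rw [hT (T h), inner_add_right, inner_smul_right, real_inner_self_eq_norm_sq, add_mul]
    gcongr
    calc inner ℝ (T h) (H (T h)) ≤ ‖T h‖ * ‖H (T h)‖ := real_inner_le_norm _ _
      _ ≤ ‖T h‖ * (‖H‖ * ‖T h‖) := by gcongr; exact H.le_opNorm _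
      _ = _ := by ring
  have h3 : inner ℝ (h - μ • H h) (T (h - μ • H h)) = (1 + μ * κ) ^ 2 * inner ℝ h (T h) -
      2 * (1 + μ * κ) * μ * ‖T h‖ ^ 2 + μ ^ 2 * inner ℝ (T h) (T (T h)) := by
    rw [h1, map_sub, map_smul, map_smul, inner_sub_left, inner_sub_right, inner_sub_right]
    simp only [inner_smul_left, inner_smul_right, RCLike.conj_to_real]
    rw [← hTsymm h (T h), real_inner_self_eq_norm_sq]
    ring
  have h4 : c ^ 2 * ‖h‖ ^ 2 ≤ ‖T h‖ ^ 2 := by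
    rw [← mul_pow]
    gcongr
    exact hcT h
  rw [h3]
  have h5 : μ ^ 2 * inner ℝ (T h) (T (T h)) ≤ μ * (1 / 2 + μ * κ) * ‖T h‖ ^ 2 := by
    calc μ ^ 2 * inner ℝ (T h) (T (T h)) ≤ μ ^ 2 * ((‖H‖ + κ) * ‖T h‖ ^ 2) := by gcongr
      _ = μ * (μ * ‖H‖ + μ * κ) * ‖T h‖ ^ 2 := by ring
      _ ≤ _ := by gcongr
  have h6 : 0 ≤ μ * (μ * κ) * ‖T h‖ ^ 2 := by positivity
  have h7 : 0 ≤ μ * ‖T h‖ ^ 2 := by positivity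
  have h8 := mul_le_mul_of_nonneg_left h4 hμ.le
  nlinarith

variable [FiniteDimensional ℝ E]

/-- A quadratic form taking a negative value can be shifted to a nondegenerate one which still
takes a negative value. -/
theorem exists_nondegenerate_shift (H : E →L[ℝ] E) {v : E} (hv : inner ℝ v (H v) < 0) :
    ∃ κ : ℝ, 0 < κ ∧ inner ℝ v (H v + κ • v) < 0 ∧
      ∃ c : ℝ, 0 < c ∧ ∀ h, c * ‖h‖ ≤ ‖H h + κ • h‖ := by
  have hv0 : v ≠ 0 := by rintro rfl; simp at hv
  have hpos : 0 < -inner ℝ v (H v) / ‖v‖ ^ 2 := div_pos (neg_pos.2 hv) (by positivity)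
  have hfin : ((fun κ : ℝ => -κ) ⁻¹' {z | Module.End.HasEigenvalue (H : E →ₗ[ℝ] E) z}).Finite :=
    Set.Finite.preimage neg_injective.injOn (Module.End.finite_hasEigenvalue _)
  obtain ⟨κ, ⟨hκ0, hκ1⟩, hκ⟩ := ((Set.Ioo_infinite hpos).sdiff hfin).nonempty
  refine ⟨κ, hκ0, ?_, ?_⟩
  · rw [lt_div_iff₀ (by positivity)] at hκ1
    rw [inner_add_right, inner_smul_right, real_inner_self_eq_norm_sq]
    linarith
  · let T : E →ₗ[ℝ] E := (H : E →ₗ[ℝ] E) + κ • LinearMap.id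
    have hker : LinearMap.ker T = ⊥ := by
      rw [LinearMap.ker_eq_bot']
      intro h hh
      by_contra h0
      refine hκ (Module.End.hasEigenvalue_of_hasEigenvector
        ⟨Module.End.mem_eigenspace_iff.2 ?_, h0⟩)
      simp only [T, LinearMap.add_apply, LinearMap.smul_apply, LinearMap.id_apply] at hh
      rw [neg_smul]
      exact eq_neg_of_add_eq_zero_left hh
    obtain ⟨K, hK, hT⟩ := T.exists_antilipschitzWith hker
    refine ⟨(K : ℝ)⁻¹, by positivity, fun h => ?_⟩
    rw [inv_mul_le_iff₀ (by exact_mod_cast hK)]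
    simpa only [T, map_zero, dist_zero_right, LinearMap.add_apply, LinearMap.smul_apply,
      LinearMap.id_apply] using! hT.le_mul_dist h 0

/-- Near a strict saddle the gradient step expands a quadratic form on differences. -/
theorem exists_expanding_form {g : E → E} {H : E →L[ℝ] E} {a : E} {μ : ℝ}
    (hg : HasStrictFDerivAt g (ContinuousLinearMap.id ℝ E - μ • H) a)
    (hsymm : ∀ x y, inner ℝ (H x) y = inner ℝ x (H y)) (hμ : 0 < μ) (hμH : μ * ‖H‖ ≤ 1 / 2)
    {v : E} (hv : inner ℝ v (H v) < 0) :
    ∃ T : E →L[ℝ] E, inner ℝ v (T v) < 0 ∧ ∃ ρ : ℝ, 1 < ρ ∧ ∃ s ∈ 𝓝 a, ∀ x ∈ s, ∀ y ∈ s,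
      inner ℝ (g x - g y) (T (g x - g y)) ≤ ρ * inner ℝ (x - y) (T (x - y)) := by
  obtain ⟨κ, hκ, hvT, c, hc, hcT⟩ := exists_nondegenerate_shift H hv
  set T : E →L[ℝ] E := H + κ • ContinuousLinearMap.id ℝ E with hTdef
  have hT : ∀ h, T h = H h + κ • h := fun h => by simp [hTdef]
  set A : E →L[ℝ] E := ContinuousLinearMap.id ℝ E - μ • H with hA
  have hTsymm : ∀ x y, inner ℝ (T x) y = inner ℝ x (T y) := fun x y => by
    simp only [hT, inner_add_left, inner_add_right, inner_smul_left, inner_smul_right, hsymm]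
    simp
  refine ⟨T, by rwa [hT], (1 + μ * κ) ^ 2, by nlinarith [mul_pos hμ hκ], ?_⟩
  set B := 2 * ‖A‖ * ‖T‖ + ‖T‖ + 1 with hB
  have hBpos : 0 < B := by positivity
  set ε : ℝ := min 1 (μ * c ^ 2 / B) with hε
  have hεpos : 0 < ε := lt_min one_pos (by positivity)
  have hε1 : ε ≤ 1 := min_le_left _ _
  have hεB : ε * B ≤ μ * c ^ 2 := (le_div_iff₀ hBpos).1 (min_le_right _ _)
  obtain ⟨s, hs, happ⟩ := hg.approximates_deriv_on_nhds (c := ⟨ε, hεpos.le⟩) (Or.inr hεpos)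
  refine ⟨s, hs, fun x hx y hy => ?_⟩
  set h := x - y with hh
  set e := g x - g y - A h with he
  have hen : ‖e‖ ≤ ε * ‖h‖ := happ x hx y hy
  have hge : g x - g y = A h + e := by rw [he]; abel
  have hAh : A h = h - μ • H h := by simp [hA]
  have h1 := quadratic_expansion hsymm hT hκ hμ hμH hc (fun h => by rw [hT]; exact hcT h) h
  rw [← hAh] at h1
  have h2 : inner ℝ (A h + e) (T (A h + e)) =
      inner ℝ (A h) (T (A h)) + 2 * inner ℝ e (T (A h)) + inner ℝ e (T e) := by
    rw [map_add, inner_add_left, inner_add_right, inner_add_right, ← hTsymm (A h) e,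
      real_inner_comm e (T (A h))]
    ring
  have h3 : inner ℝ e (T (A h)) ≤ ε * (‖A‖ * ‖T‖) * ‖h‖ ^ 2 := by
    calc inner ℝ e (T (A h)) ≤ ‖e‖ * ‖T (A h)‖ := real_inner_le_norm _ _
      _ ≤ (ε * ‖h‖) * (‖T‖ * (‖A‖ * ‖h‖)) := by
        gcongr
        exact (T.le_opNorm _).trans (by gcongr; exact A.le_opNorm _)
      _ = _ := by ring
  have h4 : inner ℝ e (T e) ≤ ε * ‖T‖ * ‖h‖ ^ 2 := by
    calc inner ℝ e (T e) ≤ ‖e‖ * ‖T e‖ := real_inner_le_norm _ _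
      _ ≤ (ε * ‖h‖) * (‖T‖ * (1 * ‖h‖)) := by
        gcongr
        exact (T.le_opNorm _).trans (by gcongr; exact hen.trans (by gcongr))
      _ = _ := by ring
  have h5 := mul_le_mul_of_nonneg_right hεB (sq_nonneg ‖h‖)
  have h6 : 0 ≤ ε * ‖h‖ ^ 2 := by positivity
  rw [hge, h2]
  rw [hB] at h5
  nlinarith

variable [MeasurableSpace E] [BorelSpace E]

/-- The points whose whole orbit stays near a strict saddle form a null set. -/
theorem exists_open_null_trapped {g : E → E} {H : E →L[ℝ] E} {a : E} {μ : ℝ} (ν : Measure E)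
    [ν.IsAddHaarMeasure] (hgc : Continuous g)
    (hg : HasStrictFDerivAt g (ContinuousLinearMap.id ℝ E - μ • H) a)
    (hsymm : ∀ x y, inner ℝ (H x) y = inner ℝ x (H y)) (hμ : 0 < μ) (hμH : μ * ‖H‖ ≤ 1 / 2)
    {v : E} (hv : inner ℝ v (H v) < 0) :
    ∃ V, IsOpen V ∧ a ∈ V ∧ ν {x | ∀ t, g^[t] x ∈ V} = 0 := by
  obtain ⟨T, hvT, ρ, hρ, s, hs, hexp⟩ := exists_expanding_form hg hsymm hμ hμH hv
  obtain ⟨r, hr, hrs⟩ := Metric.nhds_basis_closedBall.mem_iff.1 hs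
  set W : Set E := {x | ∀ t, g^[t] x ∈ Metric.closedBall a r} with hW
  refine ⟨Metric.ball a r, Metric.isOpen_ball, Metric.mem_ball_self hr,
    measure_mono_null (t := W) (fun x hx t => Metric.ball_subset_closedBall (hx t)) ?_⟩
  have hWc : IsClosed W := by
    rw [hW, Set.ofPred_forall]
    exact isClosed_iInter fun t => Metric.isClosed_closedBall.preimage (hgc.iterate t)
  have hdiff : ∀ x ∈ W, ∀ y ∈ W, 0 ≤ inner ℝ (x - y) (T (x - y)) := by
    intro x hx y hy
    by_contra! hneg
    have h1 : ∀ t, inner ℝ (g^[t] x - g^[t] y) (T (g^[t] x - g^[t] y)) ≤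
        ρ ^ t * inner ℝ (x - y) (T (x - y)) := by
      intro t
      induction t with
      | zero => simp
      | succ t ih =>
        rw [Function.iterate_succ_apply', Function.iterate_succ_apply', pow_succ']
        refine (hexp _ (hrs (hx t)) _ (hrs (hy t))).trans ?_
        rw [mul_assoc]
        gcongr
    have h2 : ∀ t, -(‖T‖ * (2 * r) ^ 2) ≤
        inner ℝ (g^[t] x - g^[t] y) (T (g^[t] x - g^[t] y)) := by
      intro t
      set h := g^[t] x - g^[t] y
      have h3 : ‖h‖ ≤ 2 * r := by
        rw [← dist_eq_norm]
        linarith [dist_triangle_right (g^[t] x) (g^[t] y) a, Metric.mem_closedBall.1 (hx t),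
          Metric.mem_closedBall.1 (hy t)]
      refine neg_le_of_abs_le ((abs_real_inner_le_norm _ _).trans ?_)
      calc ‖h‖ * ‖T h‖ ≤ ‖h‖ * (‖T‖ * ‖h‖) := by gcongr; exact T.le_opNorm _
        _ = ‖T‖ * ‖h‖ ^ 2 := by ring
        _ ≤ _ := by gcongr
    obtain ⟨t, ht⟩ := (((tendsto_pow_atTop_atTop_of_one_lt hρ).const_mul_atTop_of_neg
      hneg).eventually_lt_atBot (-(‖T‖ * (2 * r) ^ 2))).exists
    linarith [h1 t, h2 t, mul_comm (ρ ^ t) (inner ℝ (x - y) (T (x - y)))]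
  have hae : ∀ᵐ x ∂ν, x ∈ Wᶜ := by
    refine ae_mem_of_ae_add_linearMap_mem (LinearMap.toSpanSingleton ℝ E v) volume ν
      hWc.isOpen_compl.measurableSet fun y => ?_
    have hsub : {t : ℝ | y + t • v ∈ W}.Subsingleton := by
      intro t ht t' ht'
      have h1 := hdiff _ ht _ ht'
      have h2 : y + t • v - (y + t' • v) = (t - t') • v := by module
      rw [h2, map_smul, inner_smul_left, inner_smul_right, RCLike.conj_to_real, ← mul_assoc] at h1
      by_contra hne
      have : 0 < (t - t') * (t - t') := mul_self_pos.2 (sub_ne_zero.2 hne)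
      nlinarith
    have := hsub.measure_zero (volume : Measure ℝ)
    rw [ae_iff]
    simpa using this
  simpa [ae_iff] using hae

/-- Preimages of null sets under an antilipschitz restriction are null. -/
theorem measure_preimage_null {g : E → E} {s N : Set E} (ν : Measure E) [ν.IsAddHaarMeasure]
    {c : NNReal} (hg : ∀ x ∈ s, ∀ y ∈ s, ‖x - y‖ ≤ c * ‖g x - g y‖) (hN : ν N = 0) :
    ν (s ∩ g ⁻¹' N) = 0 := by
  rcases s.eq_empty_or_nonempty with rfl | hne
  · simp
  have hinj : Set.InjOn g s := fun x hx y hy hxy => by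
    have := hg x hx y hy
    rw [hxy, sub_self, norm_zero, mul_zero] at this
    exact sub_eq_zero.1 (norm_le_zero_iff.1 this)
  have : Nonempty E := ⟨0⟩
  have hleft : ∀ x ∈ s, Function.invFunOn g s (g x) = x := fun x hx => hinj.leftInvOn_invFunOn hx
  have hlip : LipschitzOnWith c (Function.invFunOn g s) (g '' s ∩ N) := by
    refine LipschitzOnWith.of_dist_le_mul ?_
    rintro _ ⟨⟨x, hx, rfl⟩, -⟩ _ ⟨⟨y, hy, rfl⟩, -⟩
    rw [hleft x hx, hleft y hy, dist_eq_norm, dist_eq_norm]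
    exact hg x hx y hy
  have hsub : s ∩ g ⁻¹' N ⊆ Function.invFunOn g s '' (g '' s ∩ N) := fun x hx =>
    ⟨g x, ⟨⟨x, hx.1, rfl⟩, hx.2⟩, hleft x hx.1⟩
  have h1 : Measure.hausdorffMeasure (Module.finrank ℝ E) N = 0 :=
    Measure.absolutelyContinuous_isAddHaarMeasure _ ν hN
  refine Measure.absolutelyContinuous_isAddHaarMeasure ν
    (Measure.hausdorffMeasure (Module.finrank ℝ E)) (measure_mono_null hsub ?_)
  have h2 := hlip.hausdorffMeasure_image_le (d := (Module.finrank ℝ E : ℝ)) (by positivity)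
  rw [measure_mono_null Set.inter_subset_right h1, mul_zero] at h2
  exact nonpos_iff_eq_zero.1 h2

end Saddle

section Main

variable {E : Type*} [NormedAddCommGroup E] [InnerProductSpace ℝ E] [FiniteDimensional ℝ E]

theorem analyticAt_gradient {f : E → ℝ} {x : E} (hf : AnalyticAt ℝ f x) :
    AnalyticAt ℝ (gradient f) x :=
  ((InnerProductSpace.toDual ℝ E).symm.toContinuousLinearEquiv.toContinuousLinearMap.analyticAt
    (fderiv ℝ f x)).comp hf.fderiv

theorem inner_fderiv_gradient {f : E → ℝ} {x : E} (hf : AnalyticAt ℝ f x) (u w : E) :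
    inner ℝ (fderiv ℝ (gradient f) x u) w = fderiv ℝ (fderiv ℝ f) x u w := by
  have h : HasFDerivAt (gradient f)
      ((InnerProductSpace.toDual ℝ E).symm.toContinuousLinearEquiv.toContinuousLinearMap.comp
        (fderiv ℝ (fderiv ℝ f) x)) x :=
    (InnerProductSpace.toDual ℝ E).symm.toContinuousLinearEquiv.toContinuousLinearMap.hasFDerivAt.comp
      x hf.fderiv.differentiableAt.hasFDerivAt
  rw [h.fderiv]
  exact InnerProductSpace.toDual_symm_apply

theorem inner_fderiv_gradient_comm {f : E → ℝ} {x : E} (hf : AnalyticAt ℝ f x) (u w : E) :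
    inner ℝ (fderiv ℝ (gradient f) x u) w = inner ℝ u (fderiv ℝ (gradient f) x w) := by
  rw [inner_fderiv_gradient hf, real_inner_comm (fderiv ℝ (gradient f) x w) u,
    inner_fderiv_gradient hf]
  exact hf.contDiffAt.isSymmSndFDerivAt_of_omega u w

/-- For small step sizes, gradient descent started in the unit ball stays in a sublevel set
contained in a ball on which the Hessian is controlled. -/
theorem exists_descent_region {f : E → ℝ} (hf : ∀ x, AnalyticAt ℝ f x)
    (hcoercive : ∀ c : ℝ, ∃ R : ℝ, ∀ x, R ≤ ‖x‖ → c ≤ f x) :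
    ∃ c R μ0 : ℝ, 0 < μ0 ∧ (∀ x, ‖x‖ ≤ 1 → f x ≤ c) ∧ (∀ x, f x ≤ c → ‖x‖ ≤ R) ∧
      ∀ μ, 0 < μ → μ ≤ μ0 →
        (∀ x, f x ≤ c → f (x - μ • gradient f x) ≤ f x - μ / 2 * ‖gradient f x‖ ^ 2) ∧
        (∀ x, ‖x‖ ≤ R → μ * ‖fderiv ℝ (gradient f) x‖ ≤ 1 / 2) ∧
        ∀ x, ‖x‖ ≤ R → ∀ y, ‖y‖ ≤ R →
          ‖x - y‖ ≤ 2 * ‖x - μ • gradient f x - (y - μ • gradient f y)‖ := by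
  have hfc : Continuous f := continuous_iff_continuousAt.2 fun x => (hf x).continuousAt
  have hGa := fun x => analyticAt_gradient (hf x)
  have hGc : Continuous (gradient f) :=
    continuous_iff_continuousAt.2 fun x => (hGa x).continuousAt
  have hHc : Continuous (fderiv ℝ (gradient f)) :=
    continuous_iff_continuousAt.2 fun x => (hGa x).fderiv.continuousAt
  obtain ⟨c, hc⟩ := (isCompact_closedBall (0 : E) 1).exists_bound_of_continuousOn hfc.continuousOn
  obtain ⟨R, hR⟩ := hcoercive (c + 1)
  obtain ⟨M, hM⟩ := (isCompact_closedBall (0 : E) (|R| + 1)).exists_bound_of_continuousOn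
    hHc.continuousOn
  obtain ⟨B, hB⟩ := (isCompact_closedBall (0 : E) |R|).exists_bound_of_continuousOn
    hGc.continuousOn
  simp only [mem_closedBall_zero_iff] at hc hM hB
  have hM0 : 0 ≤ M := (norm_nonneg _).trans (hM 0 (by simp; positivity))
  have hB0 : 0 ≤ B := (norm_nonneg _).trans (hB 0 (by simp))
  have hsub : ∀ x, f x ≤ c → ‖x‖ ≤ |R| := fun x hx => by
    by_contra! hlt
    linarith [hR x ((le_abs_self R).trans hlt.le)]
  have hlip : ∀ x ∈ Metric.closedBall (0 : E) (|R| + 1), ∀ y ∈ Metric.closedBall (0 : E) (|R| + 1),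
      ‖gradient f x - gradient f y‖ ≤ M * ‖x - y‖ := fun x hx y hy =>
    (convex_closedBall (0 : E) _).norm_image_sub_le_of_norm_fderiv_le
      (fun z _ => (hGa z).differentiableAt) (fun z hz => hM z (by simpa using hz)) hy hx
  refine ⟨c, |R|, min (1 / (2 * (M + 1))) (1 / (B + 1)), lt_min (by positivity) (by positivity),
    fun x hx => (le_abs_self _).trans (hc x hx), hsub, fun μ hμ hμ0 => ?_⟩
  have hμM : μ * M ≤ 1 / 2 := by
    have := (le_div_iff₀ (by positivity)).1 (hμ0.trans (min_le_left _ _))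
    nlinarith
  have hμB : μ * B ≤ 1 := by
    have := (le_div_iff₀ (by positivity)).1 (hμ0.trans (min_le_right _ _))
    nlinarith
  refine ⟨fun x hx => ?_, fun x hx => ?_, fun x hx y hy => ?_⟩
  · have hxR := hsub x hx
    refine descent_step (fun z => (hf z).differentiableAt.hasGradientAt)
      (convex_closedBall (0 : E) (|R| + 1)) hlip hM0 hμ hμM (by simp; linarith) ?_
    rw [mem_closedBall_zero_iff]
    refine (norm_sub_le _ _).trans (add_le_add hxR ?_)
    rw [norm_smul, Real.norm_eq_abs, abs_of_pos hμ]
    exact (mul_le_mul_of_nonneg_left (hB x hxR) hμ.le).trans hμB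
  · exact (mul_le_mul_of_nonneg_left (hM x (by linarith)) hμ.le).trans hμM
  · have h1 := hlip x (by simp; linarith) y (by simp; linarith)
    have h2 : ‖μ • (gradient f x - gradient f y)‖ ≤ 1 / 2 * ‖x - y‖ := by
      rw [norm_smul, Real.norm_eq_abs, abs_of_pos hμ]
      nlinarith [norm_nonneg (x - y)]
    have h3 : x - y = (x - μ • gradient f x - (y - μ • gradient f y)) +
        μ • (gradient f x - gradient f y) := by module
    have h4 := norm_add_le (x - μ • gradient f x - (y - μ • gradient f y))
      (μ • (gradient f x - gradient f y))
    rw [← h3] at h4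
    linarith

variable [MeasurableSpace E] [BorelSpace E]

/-- Orbits converging to a strict saddle start in a null set. -/
theorem measure_tendsto_saddle_null (ν : Measure E) [ν.IsAddHaarMeasure] {f : E → ℝ}
    (hf : ∀ x, AnalyticAt ℝ f x) {c R μ : ℝ} (hμ : 0 < μ) (hsub : ∀ x, f x ≤ c → ‖x‖ ≤ R)
    (hinv : ∀ x, f x ≤ c → f (x - μ • gradient f x) ≤ c)
    (hH : ∀ x, ‖x‖ ≤ R → μ * ‖fderiv ℝ (gradient f) x‖ ≤ 1 / 2)
    (hanti : ∀ x, ‖x‖ ≤ R → ∀ y, ‖y‖ ≤ R →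
      ‖x - y‖ ≤ 2 * ‖x - μ • gradient f x - (y - μ • gradient f y)‖) :
    ν {x | f x ≤ c ∧ ∃ a, ‖a‖ ≤ R ∧ (∃ v, inner ℝ v (fderiv ℝ (gradient f) a v) < 0) ∧
      Tendsto (fun t => (fun z => z - μ • gradient f z)^[t] x) atTop (𝓝 a)} = 0 := by
  set g : E → E := fun z => z - μ • gradient f z with hg
  have hGa := fun x => analyticAt_gradient (hf x)
  have hgc : Continuous g := continuous_iff_continuousAt.2 fun x =>
    continuousAt_id.sub ((hGa x).continuousAt.const_smul μ)
  have hgd : ∀ a, HasStrictFDerivAt g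
      (ContinuousLinearMap.id ℝ E - μ • fderiv ℝ (gradient f) a) a := fun a =>
    (hasStrictFDerivAt_id a).sub ((hGa a).hasStrictFDerivAt.const_smul μ)
  set S : Set E := {a | ‖a‖ ≤ R ∧ ∃ v, inner ℝ v (fderiv ℝ (gradient f) a v) < 0} with hS
  have hV : ∀ a : E, ∃ V, a ∈ S → IsOpen V ∧ a ∈ V ∧ ν {x | ∀ t, g^[t] x ∈ V} = 0 := by
    intro a
    by_cases ha : a ∈ S
    · obtain ⟨haR, v, hv⟩ := ha
      obtain ⟨V, h⟩ := exists_open_null_trapped ν hgc (hgd a) (inner_fderiv_gradient_comm (hf a)) hμ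
        (hH a haR) hv
      exact ⟨V, fun _ => h⟩
    · exact ⟨∅, fun h => absurd h ha⟩
  choose V hV using hV
  obtain ⟨s, hsS, hsc, hcov⟩ := TopologicalSpace.countable_cover_nhdsWithin (f := V) (s := S)
    fun a ha => mem_nhdsWithin_of_mem_nhds ((hV a ha).1.mem_nhds (hV a ha).2.1)
  have hnull : ∀ a ∈ s, ∀ k, ν {x | f x ≤ c ∧ ∀ t, g^[t] (g^[k] x) ∈ V a} = 0 := by
    intro a ha k
    induction k with
    | zero => exact measure_mono_null (fun x hx => hx.2) (hV a (hsS ha)).2.2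
    | succ k ih =>
      have h := measure_preimage_null (g := g) (s := {x | f x ≤ c}) ν (c := 2)
        (fun x hx y hy => hanti x (hsub x hx) y (hsub y hy)) ih
      refine measure_mono_null ?_ h
      exact fun x hx => ⟨hx.1, hinv x hx.1, hx.2⟩
  refine measure_mono_null (t := ⋃ a ∈ s, ⋃ k : ℕ, {x | f x ≤ c ∧ ∀ t, g^[t] (g^[k] x) ∈ V a}) ?_
    ((measure_biUnion_null_iff hsc).2 fun a ha => measure_iUnion_null (hnull a ha))
  rintro x ⟨hx, a, haR, hav, hxa⟩
  obtain ⟨b, hb, hab⟩ := Set.mem_iUnion₂.1 (hcov (show a ∈ S from ⟨haR, hav⟩))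
  obtain ⟨k, hk⟩ := eventually_atTop.1
    (hxa.eventually ((hV b (hsS hb)).1.mem_nhds hab))
  refine Set.mem_iUnion₂.2 ⟨b, hb, Set.mem_iUnion.2 ⟨k, hx, fun t => ?_⟩⟩
  rw [← Function.iterate_add_apply]
  exact hk _ (by omega)

end Main

end AnalyticDescent

open AnalyticDescent

/-- gradient descent with small constant stepsize on a real-analytic
coercive function converges to a first-order critical point for every
initialization in the unit ball, and for almost every initialization the limit
is a second-order critical point (Hessian positive semidefinite). -/
theorem gradient_descent_analytic_convergence (n : ℕ)
    (L : EuclideanSpace ℝ (Fin n) → ℝ)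
    (hana : ∀ x, AnalyticAt ℝ L x)
    (hcoercive : ∀ c : ℝ, ∃ R : ℝ, ∀ x, R ≤ ‖x‖ → c ≤ L x) :
    ∃ μ0 : ℝ, 0 < μ0 ∧ ∀ μ : ℝ, 0 < μ → μ ≤ μ0 →
      (∀ x : ℕ → EuclideanSpace ℝ (Fin n), ‖x 0‖ ≤ 1 →
        (∀ t : ℕ, x (t + 1) = x t - μ • gradient L (x t)) →
        ∃ xlim : EuclideanSpace ℝ (Fin n),
          Tendsto x atTop (nhds xlim) ∧ gradient L xlim = 0) ∧
      (∀ᵐ x0 ∂(volume : Measure (EuclideanSpace ℝ (Fin n))), ‖x0‖ ≤ 1 →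
        ∀ x : ℕ → EuclideanSpace ℝ (Fin n), x 0 = x0 →
          (∀ t : ℕ, x (t + 1) = x t - μ • gradient L (x t)) →
          ∃ xlim : EuclideanSpace ℝ (Fin n),
            Tendsto x atTop (nhds xlim) ∧ gradient L xlim = 0 ∧
            ∀ h : EuclideanSpace ℝ (Fin n), 0 ≤ iteratedFDeriv ℝ 2 L xlim ![h, h]) := by
  obtain ⟨c, R, μ0, hμ0, hball, hsub, hreg⟩ := exists_descent_region hana hcoercive
  refine ⟨μ0, hμ0, fun μ hμ hμle => ?_⟩
  obtain ⟨hdesc, hH, hanti⟩ := hreg μ hμ hμle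
  have hinv : ∀ x, L x ≤ c → L (x - μ • gradient L x) ≤ c := fun x hx =>
    (hdesc x hx).trans (by nlinarith [sq_nonneg ‖gradient L x‖])
  have hstay : ∀ x : ℕ → EuclideanSpace ℝ (Fin n), ‖x 0‖ ≤ 1 →
      (∀ t : ℕ, x (t + 1) = x t - μ • gradient L (x t)) → ∀ t, L (x t) ≤ c := by
    intro x hx0 hx t
    induction t with
    | zero => exact hball _ hx0
    | succ t ih => rw [hx t]; exact hinv _ ih
  have hloj : ∀ a, ∃ N : ℕ, ∃ C : ℝ, 0 < C ∧
      ∀ᶠ x in nhds a, |L x - L a| ^ N ≤ (C * ‖gradient L x‖) ^ (N + 1) := fun a => by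
    obtain ⟨N, C, hC, h⟩ := lojasiewicz (hana a)
    refine ⟨N, C, hC, ?_⟩
    simpa only [gradient, LinearIsometryEquiv.norm_map] using h
  have hconv : ∀ x : ℕ → EuclideanSpace ℝ (Fin n), ‖x 0‖ ≤ 1 →
      (∀ t : ℕ, x (t + 1) = x t - μ • gradient L (x t)) →
      ∃ xlim : EuclideanSpace ℝ (Fin n), Tendsto x atTop (nhds xlim) ∧ gradient L xlim = 0 := by
    intro x hx0 hx
    have hst := hstay x hx0 hx
    exact exists_limit_of_descent (continuous_iff_continuousAt.2 fun x => (hana x).continuousAt)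
      (continuous_iff_continuousAt.2 fun x => (analyticAt_gradient (hana x)).continuousAt) hloj hμ
      hx (fun t => hsub _ (hst t)) fun t => by rw [hx t]; exact hdesc _ (hst t)
  refine ⟨hconv, ?_⟩
  filter_upwards [compl_mem_ae_iff.2
    (measure_tendsto_saddle_null volume hana hμ hsub hinv hH hanti)] with x0 hx0 hx01 x hxx hx
  subst hxx
  obtain ⟨a, hxa, ha⟩ := hconv x hx01 hx
  refine ⟨a, hxa, ha, fun h => ?_⟩
  by_contra! hneg
  refine hx0 ⟨hball _ hx01, a, ?_, ⟨h, ?_⟩, ?_⟩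
  · exact le_of_tendsto hxa.norm (Eventually.of_forall fun t => hsub _ (hstay x hx01 hx t))
  · rw [real_inner_comm, inner_fderiv_gradient (hana a)]
    simpa [iteratedFDeriv_two_apply] using hneg
  · refine hxa.congr fun t => ?_
    induction t with
    | zero => rfl
    | succ t ih => rw [Function.iterate_succ_apply', ← ih, hx t]
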